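/- arXiv:2502.21064 — 4 statements merged into one kernel-verified Lean document; each statement's English description precedes it below -/
import Mathlib

section
/- Let A be an abelian category, d ≥ 1, and let U be a full additive subcategory of A which is d-rigid (Ext^i(U,U') = 0 for all 0 < i < d and U, U' in U). For any integer j with 1 ≤ j < d, the full subcategory U^j(A) consisting of objects E admitting an exact sequence 0 → E → U^1 → ⋯ → U^j → 0 with all U^i in U is closed under extensions in A. -/
open CategoryTheory CategoryTheory.Limits

universe v u

variable (A : Type u) [Category.{v} A] [Abelian A]

/-- An exact sequence `0 → Y → E_n → ⋯ → E_1 → X → 0` with `n` middle terms `E_n, …, E_1`,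
encoded as an `ℕ`-indexed complex with `ob 0 ≅ X`, `ob (n+1) ≅ Y`, zero objects in degrees
above `n+1`, exactness at every position `≥ 1` and an epimorphism at the bottom. -/
structure ExtSeq (n : ℕ) (X Y : A) where
  ob : ℕ → A
  d : ∀ i : ℕ, ob (i + 1) ⟶ ob i
  iso0 : ob 0 ≅ X
  isoTop : ob (n + 1) ≅ Y
  is_zero : ∀ i, n + 1 < i → IsZero (ob i)
  w : ∀ i, d (i + 1) ≫ d i = 0
  ex : ∀ i, (ShortComplex.mk (d (i + 1)) (d i) (w i)).Exact
  epi0 : Epi (d 0)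

variable {A}

/-- A morphism of `n`-extensions inducing the identity on the two end terms. -/
structure ExtSeqHom {n : ℕ} {X Y : A} (s t : ExtSeq A n X Y) where
  φ : ∀ i, s.ob i ⟶ t.ob i
  comm : ∀ i, s.d i ≫ φ i = φ (i + 1) ≫ t.d i
  φ0 : φ 0 = s.iso0.hom ≫ t.iso0.inv
  φTop : φ (n + 1) = s.isoTop.hom ≫ t.isoTop.inv

/-- Yoneda equivalence of `n`-fold extensions: the equivalence relation generated by the
existence of a morphism of extensions fixing the end terms. -/
def YonedaEquiv {n : ℕ} {X Y : A} : ExtSeq A n X Y → ExtSeq A n X Y → Prop :=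
  Relation.EqvGen fun s t => Nonempty (ExtSeqHom s t)

variable (A) in
/-- `extVanish A n X Y` expresses the vanishing of the Yoneda Ext-group `Ext^n_A(X, Y)`:
all `n`-fold extensions of `X` by `Y` are Yoneda equivalent. -/
def extVanish (n : ℕ) (X Y : A) : Prop :=
  ∀ s t : ExtSeq A n X Y, YonedaEquiv s t

variable (A) in
/-- `coresSet 𝒰 j` is the class `𝒰^j(A)` of objects `E` admitting an exact sequence
`0 → E → U^1 → ⋯ → U^j → 0` with all `U^i ∈ 𝒰`. -/
def coresSet (𝒰 : Set A) : ℕ → Set A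
  | 0 => {E | IsZero E}
  | j + 1 => {E | ∃ (V : A) (f : E ⟶ V), V ∈ 𝒰 ∧ Mono f ∧ cokernel f ∈ coresSet 𝒰 j}

variable (A) in
/-- `resSet 𝒰 j` is the class `𝒰_j(A)` of objects `E` admitting an exact sequence
`0 → U_j → ⋯ → U_1 → E → 0` with all `U_i ∈ 𝒰`. -/
def resSet (𝒰 : Set A) : ℕ → Set A
  | 0 => {E | IsZero E}
  | j + 1 => {E | ∃ (V : A) (f : V ⟶ E), V ∈ 𝒰 ∧ Epi f ∧ kernel f ∈ resSet 𝒰 j}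

/-- The extension lies (admissibly) in the subcategory `𝒮`: all its terms and all the
images of its differentials (the splice objects) belong to `𝒮`. -/
def ExtSeq.allIn {n : ℕ} {X Y : A} (s : ExtSeq A n X Y) (𝒮 : Set A) : Prop :=
  (∀ i, i ≤ n + 1 → s.ob i ∈ 𝒮) ∧ ∀ i, 1 ≤ i → i ≤ n → (image (s.d i) : A) ∈ 𝒮

/-- Yoneda equivalence computed inside the subcategory `𝒮`: the equivalence relation
generated by morphisms of extensions between extensions lying in `𝒮`. -/
def YonedaEquivIn (𝒮 : Set A) {n : ℕ} {X Y : A} :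
    ExtSeq A n X Y → ExtSeq A n X Y → Prop :=
  Relation.EqvGen fun s t => s.allIn 𝒮 ∧ t.allIn 𝒮 ∧ Nonempty (ExtSeqHom s t)

variable (A) in
/-- `𝒰` is closed under `d`-extensions in `A`. -/
def DExtClosed (𝒰 : Set A) (d : ℕ) : Prop :=
  ∀ (X Y : A), X ∈ 𝒰 → Y ∈ 𝒰 → ∀ s : ExtSeq A d X Y,
    ∃ t : ExtSeq A d X Y, (∀ i, 1 ≤ i → i ≤ d → t.ob i ∈ 𝒰) ∧ YonedaEquiv s t

universe w

open Abelian in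
lemma ext_efface {A : Type u} [Category.{v} A] [Abelian A] [HasExt.{w} A] {X Y : A} (n : ℕ)
    (x : Ext X Y (n+1)) : ∃ (P : A) (p : P ⟶ X), Epi p ∧
      (Ext.mk₀ p).comp x (zero_add _) = 0 := by
  let := HasDerivedCategory.standard A
  let F := HomologicalComplex.single A (ComplexShape.up ℤ) 0
  let c := (DerivedCategory.Q.commShiftIso ((n+1 : ℕ) : ℤ)).app (F.obj Y)
  let f : DerivedCategory.Q.obj (F.obj X) ⟶
      DerivedCategory.Q.obj ((shiftFunctor (CochainComplex A ℤ) ((n+1 : ℕ) : ℤ)).obj (F.obj Y)) :=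
    x.hom ≫ c.inv
  obtain ⟨K, s, hs, g, hf⟩ := DerivedCategory.right_fac f
  have hq : QuasiIso s := (DerivedCategory.isIso_Q_map_iff_quasiIso _ s).1 hs
  let i : F.obj (K.cycles 0) ⟶ K :=
    HomologicalComplex.mkHomFromSingle (K.iCycles 0) (fun k _ => by simp)
  let p := F.preimage (i ≫ s)
  have hp : F.map p = i ≫ s := F.map_preimage _
  refine ⟨K.cycles 0, p, ?_, ?_⟩
  · have h0 : Epi (K.iCycles 0 ≫ s.f 0) := by
      rw [← HomologicalComplex.cyclesMap_i]
      have : IsIso (HomologicalComplex.homologyπ (F.obj X) 0) := by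
        apply HomologicalComplex.isIso_homologyπ _ (-1) 0 (by simp)
        apply IsZero.eq_of_src
        exact HomologicalComplex.isZero_single_obj_X _ _ _ _ (by decide)
      have : IsIso (HomologicalComplex.iCycles (F.obj X) 0) := by
        apply HomologicalComplex.isIso_iCycles _ 0 1 (by simp)
        apply IsZero.eq_of_tgt
        exact HomologicalComplex.isZero_single_obj_X _ _ _ _ (by decide)
      have h1 : Epi (HomologicalComplex.cyclesMap s 0 ≫ HomologicalComplex.homologyπ _ 0) := by
        rw [← HomologicalComplex.homologyπ_naturality]
        infer_instance
      have h2 : Epi (HomologicalComplex.cyclesMap s 0) := by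
        have := epi_comp (HomologicalComplex.cyclesMap s 0 ≫ HomologicalComplex.homologyπ _ 0)
          (inv (HomologicalComplex.homologyπ (F.obj X) 0))
        simpa using this
      infer_instance
    have h2 : (F.map p).f 0 = i.f 0 ≫ s.f 0 := by rw [hp]; rfl
    have h3 : i.f 0 = (HomologicalComplex.singleObjXSelf (ComplexShape.up ℤ) 0 (K.cycles 0)).hom
        ≫ K.iCycles 0 := HomologicalComplex.mkHomFromSingle_f _ _
    have h5 : (F.map p).f 0 = (HomologicalComplex.singleObjXSelf (ComplexShape.up ℤ) 0 _).hom ≫ p ≫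
        (HomologicalComplex.singleObjXSelf (ComplexShape.up ℤ) 0 X).inv :=
      HomologicalComplex.single_map_f_self _ _ _
    have h4 : p = (K.iCycles 0 ≫ s.f 0) ≫
        (HomologicalComplex.singleObjXSelf (ComplexShape.up ℤ) 0 X).hom := by
      rw [h2, h3, Category.assoc, cancel_epi] at h5
      rw [h5]
      exact (by simp : p = (p ≫ (HomologicalComplex.singleObjXSelf (ComplexShape.up ℤ) 0 X).inv) ≫
        (HomologicalComplex.singleObjXSelf (ComplexShape.up ℤ) 0 X).hom)
    rw [h4]
    exact epi_comp _ _
  · apply Ext.ext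
    rw [Ext.comp_hom, Ext.zero_hom, Ext.mk₀_hom, ShiftedHom.mk₀_comp]
    have : i ≫ g = 0 := by
      apply HomologicalComplex.from_single_hom_ext
      apply IsZero.eq_of_tgt
      change IsZero ((F.obj Y).X (0 + ((n+1 : ℕ) : ℤ)))
      exact HomologicalComplex.isZero_single_obj_X _ _ _ _ (by lia)
    have h : DerivedCategory.Q.map (F.map p) ≫ f = 0 := by
      rw [hp, hf, Functor.map_comp, Category.assoc, IsIso.hom_inv_id_assoc, ← Functor.map_comp,
        this, Functor.map_zero]
    have hx : x.hom = f ≫ c.hom := c.comp_inv_eq.1 rfl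
    rw [hx]
    have h' : DerivedCategory.Q.map (F.map p) ≫ f ≫ c.hom = 0 := by
      rw [← Category.assoc, h, zero_comp]
    exact h'

section Helpers

open Abelian
open scoped ZeroObject

lemma exact_comp_mono {A : Type u} [Category.{v} A] [Abelian A] {X Y Z W : A} (f : X ⟶ Y)
    (g : Y ⟶ Z) (m : Z ⟶ W) [Mono m] (w : f ≫ g = 0) (w' : f ≫ g ≫ m = 0) :
    (ShortComplex.mk f g w).Exact ↔ (ShortComplex.mk f (g ≫ m) w').Exact := by
  let φ : ShortComplex.mk f g w ⟶ ShortComplex.mk f (g ≫ m) w' :=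
    { τ₁ := 𝟙 _, τ₂ := 𝟙 _, τ₃ := m }
  have : Epi φ.τ₁ := by dsimp [φ]; infer_instance
  have : IsIso φ.τ₂ := by dsimp [φ]; infer_instance
  have : Mono φ.τ₃ := by dsimp [φ]; infer_instance
  exact ShortComplex.exact_iff_of_epi_of_isIso_of_mono φ

lemma exact_epi_comp {A : Type u} [Category.{v} A] [Abelian A] {X Y Z W : A} (e : W ⟶ X)
    (f : X ⟶ Y) (g : Y ⟶ Z) [Epi e] (w : f ≫ g = 0) (w' : (e ≫ f) ≫ g = 0) :
    (ShortComplex.mk (e ≫ f) g w').Exact ↔ (ShortComplex.mk f g w).Exact := by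
  let φ : ShortComplex.mk (e ≫ f) g w' ⟶ ShortComplex.mk f g w :=
    { τ₁ := e, τ₂ := 𝟙 _, τ₃ := 𝟙 _ }
  have : Epi φ.τ₁ := by dsimp [φ]; infer_instance
  have : IsIso φ.τ₂ := by dsimp [φ]; infer_instance
  have : Mono φ.τ₃ := by dsimp [φ]; infer_instance
  exact ShortComplex.exact_iff_of_epi_of_isIso_of_mono φ

/-- A sequence of short exact sequences `0 → Z (i+1) → E i → Z i → 0`. -/
structure Chn (A : Type u) [Category.{v} A] [Abelian A] where
  Z : ℕ → A
  E : ℕ → A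
  ι : ∀ i, Z (i + 1) ⟶ E i
  e : ∀ i, E i ⟶ Z i
  w : ∀ i, ι i ≫ e i = 0
  se : ∀ i, (ShortComplex.mk (ι i) (e i) (w i)).ShortExact

variable {A : Type u} [Category.{v} A] [Abelian A]

section
variable [HasExt.{w} A]

/-- The iterated Yoneda product of the short exact sequences in a chain. -/
noncomputable def Chn.cls (c : Chn A) : ∀ n : ℕ, Ext (c.Z 0) (c.Z n) n
  | 0 => Ext.mk₀ (𝟙 _)
  | n + 1 => (Chn.cls c n).comp (c.se n).extClass rfl

lemma Chn.cls_naturality (c c' : Chn A) (ψ : ∀ i, c.Z i ⟶ c'.Z i) (φ : ∀ i, c.E i ⟶ c'.E i)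
    (h₁ : ∀ i, c.ι i ≫ φ i = ψ (i + 1) ≫ c'.ι i) (h₂ : ∀ i, c.e i ≫ ψ i = φ i ≫ c'.e i) (n : ℕ) :
    (c.cls n).comp (Ext.mk₀ (ψ n)) (add_zero n) =
      (Ext.mk₀ (ψ 0)).comp (c'.cls n) (zero_add n) := by
  induction n with
  | zero => simp [Chn.cls]
  | succ n ih =>
    have := ShortComplex.ShortExact.extClass_naturality (c.se n) (c'.se n)
      { τ₁ := ψ (n + 1), τ₂ := φ n, τ₃ := ψ n, comm₁₂ := (h₁ n).symm, comm₂₃ := (h₂ n).symm }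
    dsimp at this
    simp only [Chn.cls]
    rw [Ext.comp_assoc_of_third_deg_zero, this, ← Ext.comp_assoc_of_second_deg_zero, ih,
      Ext.comp_assoc _ _ _ _ _ (by lia)]

/-- `x` is represented by a chain which stops at `n`. -/
def RepByChn {X Y : A} (n : ℕ) (x : Ext X Y n) : Prop :=
  ∃ (c : Chn A) (a : c.Z 0 ≅ X) (b : c.Z n ≅ Y), IsIso (c.e n) ∧ (∀ i, n < i → IsZero (c.E i)) ∧
    c.cls n = (Ext.mk₀ a.hom).comp (x.comp (Ext.mk₀ b.inv) (add_zero _)) (zero_add _)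

end

lemma shortExact_zero_left {X Y Z : A} (f : X ⟶ Y) (g : Y ⟶ Z) (w : f ≫ g = 0) (hX : IsZero X)
    [IsIso g] : (ShortComplex.mk f g w).ShortExact := by
  have hm : Mono f := ⟨fun _ _ _ => hX.eq_of_tgt _ _⟩
  have he : Epi g := inferInstance
  refine { exact := ?_, mono_f := hm, epi_g := he }
  rw [ShortComplex.exact_iff_mono _ (hX.eq_of_src _ _)]
  dsimp; infer_instance

/-- The trivial chain. -/
noncomputable def Chn.triv (Y : A) : Chn A where
  Z := fun | 0 => Y | _ + 1 => 0
  E := fun | 0 => Y | _ + 1 => 0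
  ι := fun _ => 0
  e := fun | 0 => 𝟙 Y | _ + 1 => 𝟙 0
  w := fun _ => by simp
  se := fun
    | 0 => shortExact_zero_left (A := A) _ _ _ (isZero_zero A)
    | _ + 1 => shortExact_zero_left (A := A) _ _ _ (isZero_zero A)

lemma shortExact_precomp_iso (S : ShortComplex A) (hS : S.ShortExact) {Z : A} (a : Z ≅ S.X₁)
    (w : (a.hom ≫ S.f) ≫ S.g = 0) : (ShortComplex.mk (a.hom ≫ S.f) S.g w).ShortExact := by
  refine ShortComplex.shortExact_of_iso (ShortComplex.isoMk a.symm (Iso.refl _) (Iso.refl _)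
        ?_ ?_ : S ≅ ShortComplex.mk (a.hom ≫ S.f) S.g w) hS <;> simp

/-- Splice a short exact sequence with a chain. -/
noncomputable def Chn.cons (S : ShortComplex A) (hS : S.ShortExact) (c : Chn A) (a : c.Z 0 ≅ S.X₁) :
    Chn A where
  Z := fun | 0 => S.X₃ | i + 1 => c.Z i
  E := fun | 0 => S.X₂ | i + 1 => c.E i
  ι := fun | 0 => a.hom ≫ S.f | i + 1 => c.ι i
  e := fun | 0 => S.g | i + 1 => c.e i
  w := fun | 0 => by simp | i + 1 => c.w i
  se := fun
    | 0 => shortExact_precomp_iso S hS a _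
    | i + 1 => c.se i

variable [HasExt.{w} A]

lemma Chn.cls_cons (S : ShortComplex A) (hS : S.ShortExact) (c : Chn A) (a : c.Z 0 ≅ S.X₁) (n : ℕ) :
    (Chn.cons S hS c a).cls (n + 1) =
      ((Chn.cons S hS c a).se 0).extClass.comp (c.cls n) (add_comm 1 n) := by
  induction n with
  | zero =>
    exact (Ext.mk₀_id_comp _).trans (Ext.comp_mk₀_id _).symm
  | succ n ih =>
    have h1 : (Chn.cons S hS c a).cls (n + 2) =
      ((Chn.cons S hS c a).cls (n + 1)).comp (c.se n).extClass rfl := rfl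
    rw [h1, ih]
    exact Ext.comp_assoc _ _ _ _ _ (by lia)

lemma RepByChn.triv (Y : A) : RepByChn 0 (Ext.mk₀ (𝟙 Y)) := by
  refine ⟨Chn.triv Y, Iso.refl _, Iso.refl _, ?_, ?_, ?_⟩
  · change IsIso (𝟙 Y); infer_instance
  · rintro (_ | i) hi
    · lia
    · exact isZero_zero A
  · change Ext.mk₀ (𝟙 Y) = (Ext.mk₀ (𝟙 Y)).comp ((Ext.mk₀ (𝟙 Y)).comp (Ext.mk₀ (𝟙 Y)) _) _
    simp

lemma ext_assoc_aux {X K K' Y Y' : A} {n m : ℕ} (ε : Ext X K 1) (α : Ext K K' 0) (y : Ext K' Y n)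
    (β : Ext Y Y' 0) {h : 1 + n = m} :
    ε.comp (α.comp (y.comp β (add_zero _)) (zero_add _)) h =
      ((ε.comp α (add_zero 1)).comp y h).comp β (add_zero _) := by
  simp

lemma RepByChn.cons (S : ShortComplex A) (hS : S.ShortExact) {Y : A} {n : ℕ} (y : Ext S.X₁ Y n)
    (hy : RepByChn n y) : RepByChn (n + 1) (hS.extClass.comp y (add_comm 1 n)) := by
  obtain ⟨c, a, b, h1, h2, h3⟩ := hy
  refine ⟨Chn.cons S hS c a, Iso.refl _, b, h1, ?_, ?_⟩
  · rintro (_ | i) hi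
    · lia
    · exact h2 i (by lia)
  · have hn := ShortComplex.ShortExact.extClass_naturality ((Chn.cons S hS c a).se 0) hS
      { τ₁ := a.hom, τ₂ := 𝟙 _, τ₃ := 𝟙 _, 
        comm₁₂ := (Category.comp_id (a.hom ≫ S.f)).symm ▸ rfl
        comm₂₃ := (Category.id_comp S.g).trans (Category.comp_id S.g).symm }
    have hn' : ((Chn.cons S hS c a).se 0).extClass.comp (Ext.mk₀ a.hom) (add_zero 1) =
      hS.extClass := hn.trans (Ext.mk₀_id_comp _)
    rw [Chn.cls_cons, h3, ← hn']
    refine Eq.trans ?_ (Ext.mk₀_id_comp _).symm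
    exact ext_assoc_aux _ _ _ _

lemma RepByChn.all {X Y : A} (n : ℕ) (x : Ext X Y (n + 1)) : RepByChn (n + 1) x := by
  induction n generalizing X with
  | zero =>
    obtain ⟨P, p, hp, h⟩ := ext_efface 0 x
    let S := ShortComplex.mk (kernel.ι p) p (kernel.condition p)
    have hS : S.ShortExact := { exact := ShortComplex.exact_of_f_is_kernel _ (kernelIsKernel p) }
    obtain ⟨y, hy⟩ := Ext.contravariant_sequence_exact₃ hS Y x h (n₀ := 0) rfl
    obtain ⟨g, rfl⟩ := (Ext.mk₀_bijective _ _).2 y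
    change kernel p ⟶ Y at g
    let q : pushout (kernel.ι p) g ⟶ X := pushout.desc p 0 (by simp)
    have wq : pushout.inr (kernel.ι p) g ≫ q = 0 := pushout.inr_desc _ _ _
    let T := ShortComplex.mk (pushout.inr (kernel.ι p) g) q wq
    have hpq : pushout.inl (kernel.ι p) g ≫ q = p := pushout.inl_desc _ _ _
    have hT : T.ShortExact := by
      have : Epi q := epi_of_epi_fac hpq
      have : Mono (pushout.inr (kernel.ι p) g) := inferInstance
      refine { exact := ?_, mono_f := this, epi_g := ‹_› }
      apply ShortComplex.exact_of_g_is_cokernel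
      have hc := hS.gIsCokernel
      refine CokernelCofork.IsColimit.ofπ' _ _ (fun {W} k hk => ?_)
      let l := hc.desc (CokernelCofork.ofπ (f := S.f) (pushout.inl (kernel.ι p) g ≫ k) (by
        dsimp [S]
        rw [pushout.condition_assoc]
        rw [show pushout.inr (kernel.ι p) g ≫ k = 0 from hk, comp_zero]))
      have hl : p ≫ l = pushout.inl (kernel.ι p) g ≫ k :=
        hc.fac _ WalkingParallelPair.one
      refine ⟨l, ?_⟩
      dsimp [T]
      apply pushout.hom_ext
      · rw [← Category.assoc, hpq, hl]
      · rw [← Category.assoc, wq, zero_comp]; exact hk.symm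
    have hn := ShortComplex.ShortExact.extClass_naturality hS hT
      { τ₁ := g, τ₂ := pushout.inl _ _, τ₃ := 𝟙 _, 
        comm₁₂ := by exact pushout.condition.symm
        comm₂₃ := by exact hpq.trans (Category.comp_id _).symm }
    have hx : hT.extClass.comp (Ext.mk₀ (𝟙 Y)) (add_comm 1 0) = x := by
      rw [← hy]
      exact (Ext.comp_mk₀_id _).trans ((Ext.mk₀_id_comp _).symm.trans hn.symm)
    rw [← hx]
    exact RepByChn.cons T hT _ (RepByChn.triv Y)
  | succ n ih =>
    obtain ⟨P, p, hp, h⟩ := ext_efface _ x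
    let S := ShortComplex.mk (kernel.ι p) p (kernel.condition p)
    have hS : S.ShortExact := { exact := ShortComplex.exact_of_f_is_kernel _ (kernelIsKernel p) }
    obtain ⟨y, hy⟩ := Ext.contravariant_sequence_exact₃ hS Y x h (n₀ := n + 1) (by lia)
    rw [← hy]
    exact RepByChn.cons S hS _ (ih y)

end Helpers

section Bridge

open Abelian

variable {A : Type u} [Category.{v} A] [Abelian A]

/-- A factorization of an extension into short exact sequences. -/
structure Fac {n : ℕ} {X Y : A} (s : ExtSeq A n X Y) where
  Z : ℕ → A
  ι : ∀ i, Z (i + 1) ⟶ s.ob (i + 1)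
  e : ∀ i, s.ob (i + 1) ⟶ Z i
  w : ∀ i, ι i ≫ e i = 0
  se : ∀ i, (ShortComplex.mk (ι i) (e i) (w i)).ShortExact
  z0 : Z 0 ≅ s.ob 0
  fac0 : e 0 ≫ z0.hom = s.d 0
  fac : ∀ i, e (i + 1) ≫ ι i = s.d (i + 1)

variable {n : ℕ} {X Y : A} {s t : ExtSeq A n X Y}

/-- The underlying chain. -/
def Fac.toChn (F : Fac s) : Chn A where
  Z := F.Z
  E := fun i => s.ob (i + 1)
  ι := F.ι
  e := F.e
  w := F.w
  se := F.se

lemma Fac.epi_e (F : Fac s) (i : ℕ) : Epi (F.e i) := (F.se i).epi_g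
lemma Fac.mono_ι (F : Fac s) (i : ℕ) : Mono (F.ι i) := (F.se i).mono_f

lemma Fac.isIso (F : Fac s) : IsIso (F.e n) := by
  have h0 : IsZero (s.ob (n + 2)) := s.is_zero _ (by lia)
  have := F.epi_e (n + 1)
  have h1 : IsZero (F.Z (n + 1)) := by
    rw [IsZero.iff_id_eq_zero, ← cancel_epi (F.e (n + 1))]
    exact h0.eq_of_src _ _
  have h2 : Mono (F.e n) :=
    (ShortComplex.exact_iff_mono _ (h1.eq_of_src _ _)).1 (F.se n).exact
  have := F.epi_e n
  exact isIso_of_mono_of_epi _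

lemma exists_fac (s : ExtSeq A n X Y) : Nonempty (Fac s) := by
  refine ⟨{
    Z := fun | 0 => s.ob 0 | i + 1 => kernel (s.d i)
    ι := fun i => kernel.ι (s.d i)
    e := fun | 0 => s.d 0 | i + 1 => kernel.lift (s.d i) (s.d (i + 1)) (s.w i)
    w := fun
      | 0 => kernel.condition _
      | i + 1 => by
        rw [← cancel_mono (kernel.ι (s.d i))]
        simp
    se := fun
      | 0 => ?_
      | i + 1 => ?_
    z0 := Iso.refl _
    fac0 := Category.comp_id _
    fac := fun i => kernel.lift_ι _ _ _ }⟩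
  · exact { exact := ShortComplex.exact_of_f_is_kernel _ (kernelIsKernel (s.d 0))
            mono_f := inferInstanceAs (Mono (kernel.ι (s.d 0)))
            epi_g := s.epi0 }
  · have he : Epi (kernel.lift (s.d i) (s.d (i + 1)) (s.w i)) := (s.ex i).epi_kernelLift
    refine { exact := ?_
             mono_f := inferInstanceAs (Mono (kernel.ι (s.d (i + 1))))
             epi_g := he }
    refine (exact_comp_mono (kernel.ι (s.d (i + 1))) (kernel.lift (s.d i) (s.d (i + 1)) (s.w i))
      (kernel.ι (s.d i)) ?_ (by simp)).2 ?_
    · have : ∀ (k : s.ob (i + 2) ⟶ s.ob (i + 1)) (_ : k = s.d (i + 1))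
        (w : kernel.ι (s.d (i + 1)) ≫ k = 0),
          (ShortComplex.mk (kernel.ι (s.d (i + 1))) k w).Exact := by
        rintro _ rfl w
        exact ShortComplex.exact_of_f_is_kernel _ (kernelIsKernel (s.d (i + 1)))
      exact this _ (kernel.lift_ι _ _ _) _

section
variable [HasExt.{w} A]

/-- The map to the top term. -/
noncomputable def Fac.top (F : Fac s) : F.Z n ⟶ Y :=
  @inv _ _ _ _ (F.e n) F.isIso ≫ s.isoTop.hom

lemma Fac.e_top (F : Fac s) : F.e n ≫ F.top = s.isoTop.hom :=
  @IsIso.hom_inv_id_assoc _ _ _ _ (F.e n) F.isIso _ _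

/-- The class of an extension, computed by a factorization. -/
noncomputable def Fac.val (F : Fac s) : Ext X Y n :=
  (Ext.mk₀ (s.iso0.inv ≫ F.z0.inv)).comp
    ((F.toChn.cls n).comp (Ext.mk₀ F.top) (add_zero n)) (zero_add n)

lemma comp_transport {Z W Z' W' : A} (c : Ext Z Z' n) (c' : Ext W W' n) (a : X ⟶ Z) (a' : X ⟶ W)
    (p : Z ⟶ W) (p' : Z' ⟶ W') (b : Z' ⟶ Y) (b' : W' ⟶ Y)
    (key : c.comp (Ext.mk₀ p') (add_zero n) = (Ext.mk₀ p).comp c' (zero_add n))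
    (h0 : a ≫ p = a') (h1 : b = p' ≫ b') :
    (Ext.mk₀ a).comp (c.comp (Ext.mk₀ b) (add_zero n)) (zero_add n) =
      (Ext.mk₀ a').comp (c'.comp (Ext.mk₀ b') (add_zero n)) (zero_add n) := by
  subst h0 h1
  have a1 : c.comp (Ext.mk₀ (p' ≫ b')) (add_zero n) =
      (c.comp (Ext.mk₀ p') (add_zero n)).comp (Ext.mk₀ b') (add_zero n) := by
    rw [Ext.comp_assoc_of_third_deg_zero]
    exact congrArg (fun z => Ext.comp _ z _) (Ext.mk₀_comp_mk₀ _ _).symm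
  rw [a1, key, Ext.comp_assoc_of_third_deg_zero]
  exact Ext.mk₀_comp_mk₀_assoc _ _ _

lemma Fac.val_eq (F : Fac s) (G : Fac t) (φ : ExtSeqHom s t) : F.val = G.val := by
  have hψ : ∀ i, ∃ ψ : F.Z i ⟶ G.Z i, F.e i ≫ ψ = φ.φ (i + 1) ≫ G.e i := by
    intro i
    have h : F.ι i ≫ φ.φ (i + 1) ≫ G.e i = 0 := by
      have := F.epi_e (i + 1)
      rw [← cancel_epi (F.e (i + 1)), ← Category.assoc, F.fac, ← Category.assoc, φ.comm,
        Category.assoc, ← G.fac, Category.assoc, G.w, comp_zero, comp_zero, comp_zero]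
    have := (F.se i).epi_g
    exact ⟨(F.se i).exact.desc _ h, (F.se i).exact.g_desc _ h⟩
  choose ψ hψ using hψ
  have hι : ∀ i, F.ι i ≫ φ.φ (i + 1) = ψ (i + 1) ≫ G.ι i := by
    intro i
    have := F.epi_e (i + 1)
    rw [← cancel_epi (F.e (i + 1)), ← Category.assoc, F.fac, φ.comm, ← Category.assoc, hψ,
      Category.assoc, G.fac]
  have key : (F.toChn.cls n).comp (Ext.mk₀ (ψ n)) (add_zero n) =
      (Ext.mk₀ (ψ 0)).comp (G.toChn.cls n) (zero_add n) :=
    Chn.cls_naturality F.toChn G.toChn ψ (fun i => φ.φ (i + 1)) hι hψ n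
  have h0 : (s.iso0.inv ≫ F.z0.inv) ≫ ψ 0 = t.iso0.inv ≫ G.z0.inv := by
    have : ψ 0 ≫ G.z0.hom = F.z0.hom ≫ φ.φ 0 := by
      have := F.epi_e 0
      rw [← cancel_epi (F.e 0), ← Category.assoc, hψ, Category.assoc, G.fac0, ← φ.comm,
        ← Category.assoc, F.fac0]
    rw [← cancel_mono G.z0.hom, Category.assoc, this, φ.φ0]
    simp
  have h1 : F.top = ψ n ≫ G.top := by
    have := F.epi_e n
    rw [← cancel_epi (F.e n), ← Category.assoc, hψ, Category.assoc, F.e_top, G.e_top, φ.φTop]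
    simp
  exact comp_transport (F.toChn.cls n) (G.toChn.cls n) _ _ (ψ 0) (ψ n) _ _ key h0 h1

lemma val_eq_of_yonedaEquiv (h : YonedaEquiv s t) (F : Fac s) (G : Fac t) : F.val = G.val := by
  have : ∀ (s t : ExtSeq A n X Y), YonedaEquiv s t → ∀ (F : Fac s) (G : Fac t), F.val = G.val := by
    intro s t h
    induction h with
    | rel s t h => exact fun F G => Fac.val_eq F G h.some
    | refl s => exact fun F G => Fac.val_eq F G ⟨fun _ => 𝟙 _, by simp, by simp, by simp⟩
    | symm s t _ ih => exact fun F G => (ih G F).symm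
    | trans s t r _ _ h1 h2 =>
      intro F G
      obtain ⟨H⟩ := exists_fac t
      exact (h1 F H).trans (h2 H G)
  exact this s t h F G
end

/-- The extension attached to a chain. -/
noncomputable def Chn.toSeq (c : Chn A) (a : c.Z 0 ≅ X) (b : c.Z n ≅ Y) (h : IsIso (c.e n))
    (hz : ∀ i, n < i → IsZero (c.E i)) : ExtSeq A n X Y where
  ob := fun | 0 => c.Z 0 | i + 1 => c.E i
  d := fun | 0 => c.e 0 | i + 1 => c.e (i + 1) ≫ c.ι i
  iso0 := a
  isoTop := asIso (c.e n) ≪≫ b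
  is_zero := fun
    | 0, hi => by lia
    | i + 1, hi => hz i (by lia)
  w := fun
    | 0 => by dsimp only; rw [Category.assoc, c.w, comp_zero]
    | i + 1 => by dsimp only; rw [Category.assoc, reassoc_of% (c.w (i + 1)), zero_comp, comp_zero]
  ex := fun
    | 0 => by
      have := (c.se 1).epi_g
      exact (exact_epi_comp (c.e 1) (c.ι 0) (c.e 0) (c.w 0) _).2 (c.se 0).exact
    | i + 1 => by
      have : Epi (c.e (i + 2)) := (c.se (i + 2)).epi_g
      have : Mono (c.ι i) := (c.se i).mono_f
      exact (exact_epi_comp (c.e (i + 2)) (c.ι (i + 1)) (c.e (i + 1) ≫ c.ι i)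
        (by rw [reassoc_of% (c.w (i + 1)), zero_comp]) _).2
        ((exact_comp_mono _ _ _ (c.w (i + 1)) _).1 (c.se (i + 1)).exact)
  epi0 := (c.se 0).epi_g

/-- The factorization of the extension attached to a chain. -/
noncomputable def Chn.toFac (c : Chn A) (a : c.Z 0 ≅ X) (b : c.Z n ≅ Y) (h : IsIso (c.e n))
    (hz : ∀ i, n < i → IsZero (c.E i)) : Fac (c.toSeq a b h hz) where
  Z := c.Z
  ι := c.ι
  e := c.e
  w := c.w
  se := c.se
  z0 := Iso.refl _
  fac0 := Category.comp_id _
  fac := fun _ => rfl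

variable [HasExt.{w} A]

lemma RepByChn.exists_val {x : Ext X Y n} (hx : RepByChn n x) :
    ∃ (s : ExtSeq A n X Y) (F : Fac s), F.val = x := by
  obtain ⟨c, a, b, h, hz, hc⟩ := hx
  refine ⟨c.toSeq a b h hz, c.toFac a b h hz, ?_⟩
  have et : (c.toFac a b h hz).top = b.hom := by
    have : Epi (c.e n) := (c.se n).epi_g
    exact (cancel_epi (c.e n)).1 ((c.toFac a b h hz).e_top)
  have e1 : (c.toFac a b h hz).val = (Ext.mk₀ (a.inv ≫ 𝟙 _)).comp
    ((c.cls n).comp (Ext.mk₀ (c.toFac a b h hz).top) (add_zero n)) (zero_add n) := rfl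
  rw [e1, et, hc, Category.comp_id]
  simp

lemma ext_eq_zero_of_extVanish (h : extVanish A (n + 1) X Y) (x : Ext X Y (n + 1)) : x = 0 := by
  obtain ⟨s, F, rfl⟩ := (RepByChn.all n x).exists_val
  obtain ⟨t, G, h0⟩ := (RepByChn.all n (0 : Ext X Y (n + 1))).exists_val
  rw [← h0]
  exact val_eq_of_yonedaEquiv (h s t) F G

lemma ext_eq_zero_of_isZero (hX : IsZero X) (x : Ext X Y n) : x = 0 := by
  rw [← Ext.mk₀_id_comp x, hX.eq_of_src (𝟙 X) 0, Ext.mk₀_zero, Ext.zero_comp]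

lemma ext_coresSet_eq_zero (d : ℕ) (𝒰 : Set A)
    (hrigid : ∀ i, 0 < i → i < d → ∀ U ∈ 𝒰, ∀ U' ∈ 𝒰, extVanish A i U U')
    (V : A) (hV : V ∈ 𝒰) (m k : ℕ) (hmk : k + 1 + m ≤ d) (E : A) (hE : E ∈ coresSet A 𝒰 m)
    (x : Ext E V (k + 1)) : x = 0 := by
  induction m generalizing k E with
  | zero => exact ext_eq_zero_of_isZero hE x
  | succ m ih =>
    obtain ⟨U, f, hU, hf, hC⟩ := hE
    let S := ShortComplex.mk f (cokernel.π f) (cokernel.condition f)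
    have hS : S.ShortExact :=
      { exact := ShortComplex.exact_of_g_is_cokernel _ (cokernelIsCokernel f) }
    obtain ⟨y, hy⟩ := Ext.contravariant_sequence_exact₁ hS V x (add_comm 1 (k + 1))
      (ih (k + 1) (by lia) (cokernel f) hC _)
    rw [← hy, ext_eq_zero_of_extVanish (hrigid (k + 1) (by lia) (by lia) U hU V hV) y, Ext.comp_zero]

end Bridge

section Horseshoe

variable {A : Type u} [Category.{v} A] [Abelian A]

lemma horseshoe (S : ShortComplex A) (hS : S.ShortExact) {V₁ V₃ : A} (f : S.X₁ ⟶ V₁) (g : S.X₃ ⟶ V₃)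
    [Mono f] [Mono g] (l : S.X₂ ⟶ V₁) (hl : S.f ≫ l = f) :
    ∃ (h : S.X₂ ⟶ V₁ ⊞ V₃), Mono h ∧ ∃ (p : cokernel f ⟶ cokernel h) (q : cokernel h ⟶ cokernel g)
      (w : p ≫ q = 0), (ShortComplex.mk p q w).ShortExact := by
  let h : S.X₂ ⟶ V₁ ⊞ V₃ := biprod.lift l (S.g ≫ g)
  let T := ShortComplex.mk (biprod.inl : V₁ ⟶ V₁ ⊞ V₃) (biprod.snd : V₁ ⊞ V₃ ⟶ V₃) (by simp)
  have hT : T.ShortExact := (ShortComplex.Splitting.ofHasBinaryBiproduct V₁ V₃).shortExact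
  let φ : S ⟶ T :=
    { τ₁ := f, τ₂ := h, τ₃ := g
      comm₁₂ := by
        dsimp [T, h]
        apply biprod.hom_ext <;> simp [hl]
      comm₂₃ := by simp [T, h] }
  have := hS.mono_f
  have := hS.epi_g
  have := hT.mono_f
  have := hT.epi_g
  have hh : Mono h := by
    have h1 : Mono φ.τ₁ := by dsimp [φ]; infer_instance
    have h3 : Mono φ.τ₃ := by dsimp [φ]; infer_instance
    exact ShortComplex.mono_τ₂_of_exact_of_mono φ hS.exact
  have hinl : f ≫ biprod.inl = S.f ≫ h := φ.comm₁₂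
  have hsnd : h ≫ biprod.snd = S.g ≫ g := φ.comm₂₃
  have hfst : h ≫ biprod.fst = l := biprod.lift_fst _ _
  let p : cokernel f ⟶ cokernel h := cokernel.desc f (biprod.inl ≫ cokernel.π h) (by
    rw [reassoc_of% hinl, cokernel.condition, comp_zero])
  let q : cokernel h ⟶ cokernel g := cokernel.desc h (biprod.snd ≫ cokernel.π g) (by
    rw [reassoc_of% hsnd, cokernel.condition, comp_zero])
  have hp : cokernel.π f ≫ p = biprod.inl ≫ cokernel.π h := cokernel.π_desc _ _ _
  have hq : cokernel.π h ≫ q = biprod.snd ≫ cokernel.π g := cokernel.π_desc _ _ _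
  have w : p ≫ q = 0 := by
    rw [← cancel_epi (cokernel.π f), reassoc_of% hp, hq, biprod.inl_snd_assoc, zero_comp, comp_zero]
  have hqe : Epi q := by
    have : Epi (cokernel.π h ≫ q) := by rw [hq]; exact epi_comp _ _
    exact epi_of_epi (cokernel.π h) q
  have hpm : Mono p := by
    refine Preadditive.mono_of_cancel_zero _ (fun {W} x hx => ?_)
    obtain ⟨W', e, he, y, hy⟩ := surjective_up_to_refinements_of_epi (cokernel.π f) x
    have h0 : (y ≫ biprod.inl) ≫ cokernel.π h = 0 := by
      rw [Category.assoc, ← hp, ← Category.assoc, ← hy, Category.assoc, hx, comp_zero]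
    have hex : (ShortComplex.mk h (cokernel.π h) (cokernel.condition h)).Exact :=
      ShortComplex.exact_of_g_is_cokernel _ (cokernelIsCokernel h)
    have : Mono (ShortComplex.mk h (cokernel.π h) (cokernel.condition h)).f := hh
    let z : W' ⟶ S.X₂ := hex.lift (y ≫ biprod.inl) h0
    have hz : z ≫ h = y ≫ biprod.inl := hex.lift_f _ _
    have hzg : z ≫ S.g = 0 := by
      rw [← cancel_mono g, Category.assoc, ← hsnd, reassoc_of% hz, biprod.inl_snd, comp_zero,
        zero_comp]
    let t : W' ⟶ S.X₁ := hS.exact.lift z hzg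
    have ht : t ≫ S.f = z := hS.exact.lift_f _ _
    have hty : t ≫ f = y := by
      rw [← hl, reassoc_of% ht, ← hfst, reassoc_of% hz, biprod.inl_fst, Category.comp_id]
    rw [← cancel_epi e, hy, ← hty, Category.assoc, cokernel.condition, comp_zero, comp_zero]
  refine ⟨h, hh, p, q, w, { exact := ?_, mono_f := hpm, epi_g := hqe }⟩
  apply ShortComplex.exact_of_g_is_cokernel
  have hq' : Epi (ShortComplex.mk p q w).g := hqe
  refine CokernelCofork.IsColimit.ofπ' _ _ (fun {W} k hk => ?_)
  have hk' : p ≫ k = 0 := hk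
  have h1 : T.f ≫ cokernel.π h ≫ k = 0 := by
    change biprod.inl ≫ cokernel.π h ≫ k = 0
    rw [← reassoc_of% hp, hk', comp_zero]
  let m : V₃ ⟶ W := hT.exact.desc _ h1
  have hm : biprod.snd ≫ m = cokernel.π h ≫ k := hT.exact.g_desc _ h1
  have hgm : g ≫ m = 0 := by
    rw [← cancel_epi S.g, ← reassoc_of% hsnd, hm, cokernel.condition_assoc, zero_comp, comp_zero]
  refine ⟨cokernel.desc g m hgm, ?_⟩
  change q ≫ cokernel.desc g m hgm = k
  rw [← cancel_epi (cokernel.π h), reassoc_of% hq, cokernel.π_desc, hm]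

end Horseshoe

/-- if `𝒰` is a `d`-rigid full additive subcategory of an abelian category `A`
and `1 ≤ j < d`, then `𝒰^j(A)` is closed under extensions in `A`. -/
theorem coresSet_extension_closed
    (A : Type u) [Category.{v} A] [Abelian A] (d : ℕ) (hd : 1 ≤ d)
    (𝒰 : Set A)
    (hU0 : ∀ Z : A, IsZero Z → Z ∈ 𝒰)
    (hUadd : ∀ X Y : A, X ∈ 𝒰 → Y ∈ 𝒰 → (X ⊞ Y) ∈ 𝒰)
    (hUiso : ∀ X Y : A, (X ≅ Y) → X ∈ 𝒰 → Y ∈ 𝒰)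
    (hrigid : ∀ i, 0 < i → i < d → ∀ U ∈ 𝒰, ∀ U' ∈ 𝒰, extVanish A i U U')
    (j : ℕ) (hj1 : 1 ≤ j) (hjd : j < d) :
    ∀ S : ShortComplex A, S.ShortExact →
      S.X₁ ∈ coresSet A 𝒰 j → S.X₃ ∈ coresSet A 𝒰 j → S.X₂ ∈ coresSet A 𝒰 j := by
  have : HasExt.{max u v} A := HasExt.standard A
  clear hj1
  induction j with
  | zero =>
    intro S hS h1 h3
    exact hS.exact.isZero_of_both_zeros (IsZero.eq_of_src h1 _ _) (IsZero.eq_of_tgt h3 _ _)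
  | succ j ih =>
    intro S hS h1 h3
    have hvan := fun V hV =>
      ext_coresSet_eq_zero d 𝒰 hrigid V hV (j + 1) 0 (by lia) S.X₃ h3
    obtain ⟨V₁, f, hV₁, hf, hC₁⟩ := h1
    obtain ⟨V₃, g, hV₃, hg, hC₃⟩ := h3
    obtain ⟨y, hy⟩ := Abelian.Ext.contravariant_sequence_exact₁ hS V₁ (Abelian.Ext.mk₀ f)
      (add_zero 1) (hvan V₁ hV₁ _)
    obtain ⟨l, rfl⟩ := (Abelian.Ext.mk₀_bijective _ _).2 y
    rw [Abelian.Ext.mk₀_comp_mk₀] at hy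
    have hl := (Abelian.Ext.mk₀_bijective _ _).1 hy
    obtain ⟨h, hh, p, q, w, hs⟩ := horseshoe S hS f g l hl
    exact ⟨V₁ ⊞ V₃, h, hUadd _ _ hV₁ hV₃, hh, ih (by lia) _ hs hC₁ hC₃⟩
end

section
/- Let A be an abelian category, d ≥ 2, and U a d-rigid full additive subcategory of A. If 0 → E₃ → E₂ → E₁ → 0 is a short exact sequence with E₂ ∈ U^d(A) and E₁ ∈ U^{d-1}(A), then E₃ ∈ U^d(A). -/
open CategoryTheory CategoryTheory.Limits

universe v u

variable (A : Type u) [Category.{v} A] [Abelian A]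

variable {A}

namespace CoresAux

open Category HomologicalComplex in
lemma exists_epi_section {C : Type u} [Category.{v} C] [Abelian C]
    {P : C} {K : CochainComplex C ℤ}
    (π : K ⟶ (HomologicalComplex.single C (ComplexShape.up ℤ) 0).obj P)
    [K.IsStrictlyLE 0] [QuasiIsoAt π 0] :
    ∃ (Q : C) (p : Q ⟶ P) (σ : (HomologicalComplex.single C (ComplexShape.up ℤ) 0).obj Q ⟶ K),
      Epi p ∧ σ ≫ π = (HomologicalComplex.single C (ComplexShape.up ℤ) 0).map p := by
  let e := K.iCyclesIso 0 (0 + 1) (by simp)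
    ((K.isZero_of_isStrictlyLE 0 (0 + 1) (by simp)).eq_of_tgt _ _)
  let α := e.inv ≫ K.homologyπ 0 ≫ homologyMap π 0 ≫ (singleObjHomologySelfIso _ _ _).hom
  have h : π.f 0 = α ≫ (singleObjXSelf (ComplexShape.up ℤ) 0 P).inv := by
    rw [← cancel_epi e.hom]
    dsimp [α, e]
    rw [assoc, assoc, assoc, Iso.hom_inv_id_assoc,
      homologyπ_naturality_assoc, iCyclesIso_hom]
    rw [homologyπ_singleObjHomologySelfIso_hom_assoc,
      ← singleObjCyclesSelfIso_inv_iCycles, Iso.hom_inv_id_assoc, ← cyclesMap_i]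
  refine ⟨K.X 0, α, mkHomFromSingle (𝟙 _) ?_, ?_, ?_⟩
  · rintro _ rfl
    apply (K.isZero_of_isStrictlyLE 0 (0 + 1) (by simp)).eq_of_tgt
  · have : IsIso (homologyMap π 0) := by
      rw [← quasiIsoAt_iff_isIso_homologyMap]; infer_instance
    dsimp only [α]
    infer_instance
  · apply HomologicalComplex.from_single_hom_ext
    rw [comp_f, mkHomFromSingle_f, h, comp_id, single_map_f_self]

open DerivedCategory Abelian in
lemma efface_aux {C : Type u} [Category.{v} C] [Abelian C] [HasDerivedCategory.{max u v} C]
    {P : C} {L : CochainComplex C ℤ}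
    (φ : Q.obj ((CochainComplex.singleFunctor C 0).obj P) ⟶ Q.obj L)
    (n : ℤ) (hn : n < 0) [L.IsStrictlyLE n] :
    ∃ (Y : C) (p : Y ⟶ P), Epi p ∧ (Q.map ((CochainComplex.singleFunctor C 0).map p)) ≫ φ = 0 := by
  obtain ⟨K, _, π, h, g, rfl⟩ := right_fac_of_isStrictlyLE φ 0
  have h' := h
  rw [isIso_Q_map_iff_quasiIso] at h'
  let π' : K ⟶ (HomologicalComplex.single C (ComplexShape.up ℤ) 0).obj P := π
  have h'' : QuasiIso π' := h'
  obtain ⟨Y, p, σ, hp, hσ⟩ := exists_epi_section (K := K) π'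
  refine ⟨Y, p, hp, ?_⟩
  have h₂ : σ ≫ g = 0 := by
    apply HomologicalComplex.from_single_hom_ext
    apply (L.isZero_of_isStrictlyLE n 0 hn).eq_of_tgt
  change Q.map ((HomologicalComplex.single C (ComplexShape.up ℤ) 0).map p) ≫ _ = _
  rw [← hσ, Q.map_comp]
  erw [Category.assoc, IsIso.hom_inv_id_assoc]
  rw [← Q.map_comp, h₂, Q.map_zero]
  rfl

open DerivedCategory Abelian in
lemma efface {C : Type u} [Category.{v} C] [Abelian C] [HasExt.{max u v} C]
    {X Y : C} {n : ℕ} (e : Ext X Y (n + 1)) :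
    ∃ (P : C) (p : P ⟶ X), Epi p ∧ (Ext.mk₀ p).comp e (zero_add _) = 0 := by
  let := HasDerivedCategory.standard C
  obtain ⟨P, p, hp, h⟩ := efface_aux
    (L := (CochainComplex.singleFunctor C (-(n + 1))).obj Y) (P := X)
    (e.hom ≫ ((singleFunctors C).shiftIso (n + 1) (-(n + 1)) 0 (by lia)).hom.app Y)
    (-(n+1)) (by lia)
  refine ⟨P, p, hp, ?_⟩
  apply Ext.homEquiv.injective
  change ((Ext.mk₀ p).comp e (zero_add (n+1))).hom = (0 : Ext P Y (n+1)).hom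
  rw [← Ext.singleFunctor_map_comp_hom]
  simp only [← cancel_mono (((singleFunctors C).shiftIso (n + 1) (-(n + 1)) 0
    (by lia)).hom.app _), Ext.zero_hom, Limits.zero_comp]
  rw [Category.assoc]
  exact h

open Abelian

variable {A : Type u} [Category.{v} A] [Abelian A]

lemma kernelSES {P X : A} (p : P ⟶ X) [Epi p] :
    (ShortComplex.mk (kernel.ι p) p (kernel.condition p)).ShortExact where
  exact := ShortComplex.exact_of_f_is_kernel _ (kernelIsKernel p)
  mono_f := by dsimp; infer_instance
  epi_g := by dsimp; infer_instance

lemma cokernelSES {P X : A} (p : P ⟶ X) [Mono p] :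
    (ShortComplex.mk p (cokernel.π p) (cokernel.condition p)).ShortExact where
  exact := ShortComplex.exact_of_g_is_cokernel _ (cokernelIsCokernel p)
  mono_f := by dsimp; infer_instance
  epi_g := by dsimp; infer_instance

lemma isIso_d0 {X Y : A} (s : ExtSeq A 0 X Y) : IsIso (s.d 0) := by
  have := s.epi0
  have : Mono (s.d 0) :=
    (s.ex 0).mono_g ((s.is_zero 2 (by lia)).eq_of_src _ _)
  exact isIso_of_mono_of_epi _

/-- The shifted extension starting at the first kernel. -/
noncomputable def tail {n : ℕ} {X Y : A} (s : ExtSeq A (n + 1) X Y) :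
    ExtSeq A n (kernel (s.d 0)) Y where
  ob i := match i with
    | 0 => kernel (s.d 0)
    | i + 1 => s.ob (i + 2)
  d i := match i with
    | 0 => kernel.lift (s.d 0) (s.d 1) (s.w 0)
    | i + 1 => s.d (i + 2)
  iso0 := Iso.refl _
  isoTop := s.isoTop
  is_zero i hi := match i, hi with
    | 0, hi => absurd hi (by lia)
    | i + 1, hi => s.is_zero (i + 2) (by lia)
  w i := match i with
    | 0 => by
        dsimp
        rw [← cancel_mono (kernel.ι _)]
        simpa using s.w 1
    | i + 1 => s.w (i + 2)
  ex i := match i with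
    | 0 => by
        have h := s.ex 1
        let φ : ShortComplex.mk (s.d 2) (kernel.lift (s.d 0) (s.d 1) (s.w 0)) (by
            rw [← cancel_mono (kernel.ι _)]
            simpa using s.w 1) ⟶ ShortComplex.mk (s.d 2) (s.d 1) (s.w 1) :=
          { τ₁ := 𝟙 _
            τ₂ := 𝟙 _
            τ₃ := kernel.ι _ }
        have : Epi φ.τ₁ := by dsimp [φ]; infer_instance
        have : IsIso φ.τ₂ := by dsimp [φ]; infer_instance
        have : Mono φ.τ₃ := by dsimp [φ]; infer_instance
        exact (ShortComplex.exact_iff_of_epi_of_isIso_of_mono φ).2 h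
    | i + 1 => s.ex (i + 2)
  epi0 := (s.ex 0).epi_kernelLift

/-- The class of a Yoneda extension. -/
noncomputable def cls [HasExt.{max u v} A] : ∀ {n : ℕ} {X Y : A}, ExtSeq A n X Y → Ext X Y n
  | 0, _, _, s =>
      have := isIso_d0 s
      Ext.mk₀ (s.iso0.inv ≫ inv (s.d 0) ≫ s.isoTop.hom)
  | n + 1, _, _, s =>
      have := s.epi0
      (Ext.mk₀ s.iso0.inv).comp
        ((kernelSES (s.d 0)).extClass.comp (cls (tail s)) (add_comm 1 n)) (zero_add _)

lemma cls_zero [HasExt.{max u v} A] {X Y : A} (s : ExtSeq A 0 X Y) [IsIso (s.d 0)] :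
    cls s = Ext.mk₀ (s.iso0.inv ≫ inv (s.d 0) ≫ s.isoTop.hom) := rfl

lemma cls_succ [HasExt.{max u v} A] {n : ℕ} {X Y : A} (s : ExtSeq A (n + 1) X Y) [Epi (s.d 0)] :
    cls s = (Ext.mk₀ s.iso0.inv).comp
        ((kernelSES (s.d 0)).extClass.comp (cls (tail s)) (add_comm 1 n)) (zero_add _) := rfl

lemma cls_nat [HasExt.{max u v} A] {n : ℕ} : ∀ {X X' Y : A} (s : ExtSeq A n X Y)
    (t : ExtSeq A n X' Y)
    (α : X ⟶ X') (φ : ∀ i, s.ob i ⟶ t.ob i) (_ : ∀ i, s.d i ≫ φ i = φ (i + 1) ≫ t.d i)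
    (_ : φ 0 ≫ t.iso0.hom = s.iso0.hom ≫ α)
    (_ : φ (n + 1) ≫ t.isoTop.hom = s.isoTop.hom),
    cls s = (Ext.mk₀ α).comp (cls t) (zero_add n) := by
  induction n with
  | zero =>
    intro X X' Y s t α φ comm h0 hT
    have := isIso_d0 s
    have := isIso_d0 t
    rw [cls_zero, cls_zero, Ext.mk₀_comp_mk₀]
    congr 1
    rw [← cancel_epi s.iso0.hom, Iso.hom_inv_id_assoc, ← cancel_epi (s.d 0),
      IsIso.hom_inv_id_assoc, ← reassoc_of% h0, Iso.hom_inv_id_assoc, reassoc_of% (comm 0),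
      IsIso.hom_inv_id_assoc]
    exact hT.symm
  | succ n ih =>
    intro X X' Y s t α φ comm h0 hT
    have := s.epi0
    have := t.epi0
    have key := ih (tail s) (tail t) (kernel.map _ _ (φ 1) (φ 0) (comm 0))
      (fun i => match i with
        | 0 => kernel.map _ _ (φ 1) (φ 0) (comm 0)
        | i + 1 => φ (i + 2))
      (fun i => match i with
        | 0 => by
            dsimp [tail]
            rw [← cancel_mono (kernel.ι _)]
            simpa using comm 1
        | i + 1 => comm (i + 2))
      (by simp [tail]) hT
    let ψ : ShortComplex.mk (kernel.ι (s.d 0)) (s.d 0) (kernel.condition _) ⟶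
        ShortComplex.mk (kernel.ι (t.d 0)) (t.d 0) (kernel.condition _) :=
      { τ₁ := kernel.map _ _ (φ 1) (φ 0) (comm 0)
        τ₂ := φ 1
        τ₃ := φ 0
        comm₂₃ := (comm 0).symm }
    have hn := ShortComplex.ShortExact.extClass_naturality (kernelSES (s.d 0))
      (kernelSES (t.d 0)) ψ
    have e0 : s.iso0.inv ≫ φ 0 = α ≫ t.iso0.inv := by
      rw [Iso.inv_comp_eq, ← reassoc_of% h0, Iso.hom_inv_id, Category.comp_id]
    rw [cls_succ, cls_succ, key, ← Ext.comp_assoc_of_second_deg_zero]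
    erw [hn]
    rw [Ext.comp_assoc (a₁₂ := 1) (a₂₃ := n + 1) (h := by lia) (h₂₃ := by lia),
      Ext.mk₀_comp_mk₀_assoc, Ext.mk₀_comp_mk₀_assoc]
    change (Ext.mk₀ (s.iso0.inv ≫ φ 0)).comp _ _ = _
    rw [e0]

lemma cls_eq_of_yonedaEquiv [HasExt.{max u v} A] {n : ℕ} {X Y : A} (s t : ExtSeq A n X Y)
    (h : YonedaEquiv s t) : cls s = cls t := by
  induction h with
  | rel s t h =>
    obtain ⟨φ⟩ := h
    rw [cls_nat s t (𝟙 X) φ.φ φ.comm (by simp [φ.φ0]) (by simp [φ.φTop]), Ext.mk₀_id_comp]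
  | refl => rfl
  | symm _ _ _ ih => exact ih.symm
  | trans _ _ _ _ _ h1 h2 => exact h1.trans h2

/-- Splicing an extension with a short exact sequence. -/
noncomputable def splice {n : ℕ} {P X Y : A} (p : P ⟶ X) [Epi p] (s : ExtSeq A n (kernel p) Y) :
    ExtSeq A (n + 1) X Y where
  ob i := match i with
    | 0 => X
    | 1 => P
    | i + 2 => s.ob (i + 1)
  d i := match i with
    | 0 => p
    | 1 => s.d 0 ≫ s.iso0.hom ≫ kernel.ι p
    | i + 2 => s.d (i + 1)
  iso0 := Iso.refl _
  isoTop := s.isoTop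
  is_zero i hi := match i, hi with
    | 0, hi => absurd hi (by lia)
    | 1, hi => absurd hi (by lia)
    | i + 2, hi => s.is_zero (i + 1) (by lia)
  w i := match i with
    | 0 => by simp
    | 1 => by simp [reassoc_of% (s.w 0)]
    | i + 2 => s.w (i + 1)
  ex i := match i with
    | 0 => by
        let φ : ShortComplex.mk (s.d 0 ≫ s.iso0.hom ≫ kernel.ι p) p (by simp) ⟶
            ShortComplex.mk (kernel.ι p) p (kernel.condition p) :=
          { τ₁ := s.d 0 ≫ s.iso0.hom
            τ₂ := 𝟙 _
            τ₃ := 𝟙 _ }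
        have := s.epi0
        have : Epi φ.τ₁ := by dsimp [φ]; infer_instance
        have : IsIso φ.τ₂ := by dsimp [φ]; infer_instance
        have : Mono φ.τ₃ := by dsimp [φ]; infer_instance
        exact (ShortComplex.exact_iff_of_epi_of_isIso_of_mono φ).2 (kernelSES p).exact
    | 1 => by
        let φ : ShortComplex.mk (s.d 1) (s.d 0) (s.w 0) ⟶
            ShortComplex.mk (s.d 1) (s.d 0 ≫ s.iso0.hom ≫ kernel.ι p)
              (by simp [reassoc_of% (s.w 0)]) :=
          { τ₁ := 𝟙 _
            τ₂ := 𝟙 _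
            τ₃ := s.iso0.hom ≫ kernel.ι p }
        have : Epi φ.τ₁ := by dsimp [φ]; infer_instance
        have : IsIso φ.τ₂ := by dsimp [φ]; infer_instance
        have : Mono φ.τ₃ := by dsimp [φ]; infer_instance
        exact (ShortComplex.exact_iff_of_epi_of_isIso_of_mono φ).1 (s.ex 0)
    | i + 2 => s.ex (i + 1)
  epi0 := by dsimp; infer_instance

lemma cls_splice [HasExt.{max u v} A] {n : ℕ} {P X Y : A} (p : P ⟶ X) [Epi p]
    (s : ExtSeq A n (kernel p) Y) :
    cls (splice p s) = (kernelSES p).extClass.comp (cls s) (add_comm 1 n) := by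
  have := (splice p s).epi0
  have h := cls_nat s (tail (splice p s)) (𝟙 _)
    (fun i => match i with
      | 0 => s.iso0.hom
      | i + 1 => 𝟙 _)
    (fun i => match i with
      | 0 => by
          dsimp [tail, splice]
          rw [← cancel_mono (kernel.ι _)]
          simp
      | i + 1 => by
          dsimp [tail, splice]
          simp)
    (by simp [tail, splice]) (by simp [tail, splice])
  have h' : cls s = (show Ext (kernel p) Y n from cls (tail (splice p s))) :=
    h.trans (Ext.mk₀_id_comp _)
  rw [h', cls_succ]
  exact Ext.mk₀_id_comp _

/-- The one-fold extension attached to a short exact sequence. -/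
noncomputable def ofSES (S : ShortComplex A) (hS : S.ShortExact) : ExtSeq A 1 S.X₃ S.X₁ where
  ob i := match i with
    | 0 => S.X₃
    | 1 => S.X₂
    | 2 => S.X₁
    | _ + 3 => ((HasZeroObject.zero' A).zero : A)
  d i := match i with
    | 0 => S.g
    | 1 => S.f
    | _ + 2 => 0
  iso0 := Iso.refl _
  isoTop := Iso.refl _
  is_zero i hi := match i, hi with
    | 0, hi => absurd hi (by lia)
    | 1, hi => absurd hi (by lia)
    | 2, hi => absurd hi (by lia)
    | _ + 3, _ => isZero_zero _
  w i := match i with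
    | 0 => S.zero
    | 1 => by simp
    | i + 2 => by simp
  ex i := match i with
    | 0 => hS.exact
    | 1 => by
        have := hS.mono_f
        exact (ShortComplex.exact_iff_mono _ rfl).2 hS.mono_f
    | i + 2 => ShortComplex.exact_of_isZero_X₂ _ (isZero_zero _)
  epi0 := hS.epi_g

lemma extClass_ker [HasExt.{max u v} A] (S : ShortComplex A) (hS : S.ShortExact) [Epi S.g]
    (k : kernel S.g ⟶ S.X₁) (hk : kernel.lift S.g S.f S.zero ≫ k = 𝟙 _) :
    (kernelSES S.g).extClass.comp (Ext.mk₀ k) (add_zero 1) = hS.extClass := by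
  let ψ : S ⟶ ShortComplex.mk (kernel.ι S.g) S.g (kernel.condition _) :=
      { τ₁ := kernel.lift S.g S.f S.zero
        τ₂ := 𝟙 _
        τ₃ := 𝟙 _ }
  have hn := ShortComplex.ShortExact.extClass_naturality hS (kernelSES S.g) ψ
  have hn' : (kernelSES S.g).extClass =
     hS.extClass.comp (Ext.mk₀ (kernel.lift S.g S.f S.zero)) (add_zero 1) := by
    refine Eq.trans ?_ hn.symm
    exact (Ext.mk₀_id_comp _).symm
  rw [hn', Ext.comp_assoc_of_second_deg_zero, Ext.mk₀_comp_mk₀, hk, Ext.comp_mk₀_id]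

lemma cls_ofSES [HasExt.{max u v} A] (S : ShortComplex A) (hS : S.ShortExact) :
    cls (ofSES S hS) = hS.extClass := by
  have : Epi S.g := hS.epi_g
  have := (ofSES S hS).epi0
  have h1 := isIso_d0 (tail (ofSES S hS))
  rw [cls_succ, cls_zero]
  refine (Ext.mk₀_id_comp _).trans (extClass_ker S hS _ ?_)
  change (tail (ofSES S hS)).d 0 ≫ 𝟙 _ ≫ inv ((tail (ofSES S hS)).d 0) ≫ 𝟙 _ = 𝟙 _
  rw [Category.id_comp, IsIso.hom_inv_id_assoc]

lemma pushout_desc_condition {P X Y : A} (p : P ⟶ X) (f : kernel p ⟶ Y) :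
    kernel.ι p ≫ p = f ≫ (0 : Y ⟶ X) := by simp

lemma pushoutSES {P X Y : A} (p : P ⟶ X) [Epi p] (f : kernel p ⟶ Y) :
    (ShortComplex.mk (pushout.inr (kernel.ι p) f)
      (pushout.desc p (0 : Y ⟶ X) (pushout_desc_condition p f))
      (pushout.inr_desc _ _ _)).ShortExact where
  exact := by
    apply ShortComplex.exact_of_g_is_cokernel
    have hz : ∀ {Z : A} (k : pushout (kernel.ι p) f ⟶ Z),
        pushout.inr (kernel.ι p) f ≫ k = 0 → kernel.ι p ≫ pushout.inl (kernel.ι p) f ≫ k = 0 := by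
      intro Z k hk
      rw [pushout.condition_assoc, hk, comp_zero]
    have := (kernelSES p).epi_g
    refine CokernelCofork.IsColimit.ofπ _ _
      (fun {Z} k hk => (kernelSES p).exact.desc (pushout.inl (kernel.ι p) f ≫ k) (hz k hk)) ?_ ?_
    · intro Z k hk
      apply pushout.hom_ext
      · rw [pushout.inl_desc_assoc]
        exact (kernelSES p).exact.g_desc _ (hz k hk)
      · rw [pushout.inr_desc_assoc, zero_comp, hk]
    · intro Z k hk b hb
      rw [← cancel_epi p]
      refine Eq.trans ?_ ((kernelSES p).exact.g_desc _ (hz k hk)).symm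
      rw [← hb, pushout.inl_desc_assoc]
  mono_f := by dsimp; infer_instance
  epi_g := by
    have h : pushout.inl (kernel.ι p) f ≫
      (pushout.desc p (0 : Y ⟶ X) (pushout_desc_condition p f)) = p := pushout.inl_desc _ _ _
    exact epi_of_epi_fac h

lemma exists_ses [HasExt.{max u v} A] {X Y : A} (e : Ext X Y 1) :
    ∃ s : ExtSeq A 1 X Y, cls s = e := by
  obtain ⟨P, p, hp, h⟩ := efface e
  obtain ⟨x, rfl⟩ := Ext.contravariant_sequence_exact₃ (kernelSES p) Y e h (n₀ := 0) rfl
  obtain ⟨f, rfl⟩ := (Ext.mk₀_bijective _ _).2 x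
  let S : ShortComplex A := ShortComplex.mk (pushout.inr (kernel.ι p) f)
    (pushout.desc p (0 : Y ⟶ X) (pushout_desc_condition p f)) (pushout.inr_desc _ _ _)
  have hS : S.ShortExact := pushoutSES p f
  let ψ : ShortComplex.mk (kernel.ι p) p (kernel.condition _) ⟶ S :=
    { τ₁ := f
      τ₂ := pushout.inl _ _
      τ₃ := 𝟙 _
      comm₁₂ := (pushout.condition).symm
      comm₂₃ := (pushout.inl_desc _ _ _).trans (Category.comp_id p).symm }
  refine ⟨ofSES S hS, ?_⟩
  rw [cls_ofSES]
  have hn := ShortComplex.ShortExact.extClass_naturality (kernelSES p) hS ψ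
  exact ((hn.trans (Ext.mk₀_id_comp _))).symm

lemma exists_rep [HasExt.{max u v} A] {n : ℕ} : ∀ {X Y : A} (e : Ext X Y (n + 1)),
    ∃ s : ExtSeq A (n + 1) X Y, cls s = e := by
  induction n with
  | zero => exact exists_ses
  | succ n ih =>
    intro X Y e
    obtain ⟨P, p, hp, h⟩ := efface e
    obtain ⟨x, rfl⟩ := Ext.contravariant_sequence_exact₃ (kernelSES p) Y e h (n₀ := n + 1)
      (by lia)
    obtain ⟨s, rfl⟩ := ih x
    exact ⟨splice p s, cls_splice p s⟩

lemma ext_eq_zero [HasExt.{max u v} A] {n : ℕ} {X Y : A} (h : extVanish A (n + 1) X Y)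
    (e : Ext X Y (n + 1)) : e = 0 := by
  obtain ⟨s, rfl⟩ := exists_rep e
  obtain ⟨t, ht⟩ := exists_rep (0 : Ext X Y (n + 1))
  rw [← ht]
  exact cls_eq_of_yonedaEquiv _ _ (h s t)

lemma cok_ses (S₁ S₂ : ShortComplex A) (h₁ : S₁.ShortExact) (h₂ : S₂.ShortExact) (φ : S₁ ⟶ S₂)
    [Mono φ.τ₃] : ∃ T : ShortComplex A, T.ShortExact ∧ Nonempty (T.X₁ ≅ cokernel φ.τ₁) ∧
      Nonempty (T.X₂ ≅ cokernel φ.τ₂) ∧ Nonempty (T.X₃ ≅ cokernel φ.τ₃) := by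
  let S : ShortComplex.SnakeInput A :=
    { L₀ := kernel φ
      L₁ := S₁
      L₂ := S₂
      L₃ := cokernel φ
      v₀₁ := kernel.ι φ
      v₁₂ := φ
      v₂₃ := cokernel.π φ
      w₀₂ := kernel.condition φ
      w₁₃ := cokernel.condition φ
      h₀ := kernelIsKernel φ
      h₃ := cokernelIsCokernel φ
      L₁_exact := h₁.exact
      epi_L₁_g := h₁.epi_g
      L₂_exact := h₂.exact
      mono_L₂_f := h₂.mono_f }
  have : Epi S.L₂.g := h₂.epi_g
  have hm : Mono S.L₃.f := by
    refine S.L₂'_exact.mono_g ?_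
    have : Mono S.v₁₂.τ₃ := ‹Mono φ.τ₃›
    have hz : S.v₀₁.τ₃ = 0 := by
      rw [← cancel_mono S.v₁₂.τ₃, S.w₀₂_τ₃, zero_comp]
    have : Mono S.v₀₁.τ₃ := ShortComplex.SnakeInput.mono_v₀₁_τ₃ S
    exact (IsZero.of_mono_eq_zero _ hz).eq_of_src _ _
  refine ⟨S.L₃, { exact := S.L₃_exact, mono_f := hm, epi_g := ShortComplex.SnakeInput.epi_L₃_g S }, ⟨?_⟩, ⟨?_⟩, ⟨?_⟩⟩
  · exact S.h₃τ₁.coconePointUniqueUpToIso (colimit.isColimit _)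
  · exact S.h₃τ₂.coconePointUniqueUpToIso (colimit.isColimit _)
  · exact S.h₃τ₃.coconePointUniqueUpToIso (colimit.isColimit _)

lemma coresSet_iso (𝒰 : Set A) : ∀ (j : ℕ) {E E' : A} (_ : E ≅ E'), E ∈ coresSet A 𝒰 j →
    E' ∈ coresSet A 𝒰 j
  | 0, _, _, e, h => IsZero.of_iso (show IsZero _ from h) e.symm
  | j + 1, _, _, e, ⟨V, f, hV, hf, hc⟩ =>
    ⟨V, e.inv ≫ f, hV, mono_comp _ _, coresSet_iso 𝒰 j (cokernelEpiComp e.inv f).symm hc⟩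

section

variable [HasExt.{max u v} A] (d : ℕ) (𝒰 : Set A)
    (hUadd : ∀ X Y : A, X ∈ 𝒰 → Y ∈ 𝒰 → (X ⊞ Y) ∈ 𝒰)
    (hrigid : ∀ i, 0 < i → i < d → ∀ U ∈ 𝒰, ∀ U' ∈ 𝒰, extVanish A i U U')

include hrigid

lemma ext_coresSet_zero : ∀ (j : ℕ) (X W : A), X ∈ coresSet A 𝒰 j → W ∈ 𝒰 →
    ∀ i, i + 1 + j ≤ d → ∀ e : Ext X W (i + 1), e = 0
  | 0, X, W, hX, _, i, _, e => by
    have hX : IsZero X := hX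
    rw [← Ext.mk₀_id_comp e, hX.eq_of_src (𝟙 X) 0, Ext.mk₀_zero, Ext.zero_comp]
  | j + 1, X, W, ⟨V, f, hV, hf, hc⟩, hW, i, hi, e => by
    obtain ⟨x, hx⟩ := Ext.contravariant_sequence_exact₁ (cokernelSES f) W e
      (n₁ := (i + 1) + 1) (by lia) (ext_coresSet_zero j _ W hc hW (i + 1) (by lia) _)
    rw [← hx, ext_eq_zero (hrigid (i + 1) (by lia) (by lia) V hV W hW) x, Ext.comp_zero]

include hUadd

lemma coresSet_ext : ∀ (j : ℕ) (_ : j + 1 ≤ d) (S : ShortComplex A) (_ : S.ShortExact),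
    S.X₁ ∈ coresSet A 𝒰 j → S.X₃ ∈ coresSet A 𝒰 j → S.X₂ ∈ coresSet A 𝒰 j
  | 0, _, S, hS, h₁, h₃ => hS.exact.isZero_X₂ (IsZero.eq_of_src h₁ _ _) (IsZero.eq_of_tgt h₃ _ _)
  | j + 1, hj, S, hS, ⟨W, f₁, hW, hf₁, hc₁⟩, h₃@⟨V, f₃, hV, hf₃, hc₃⟩ => by
    obtain ⟨x, hx⟩ := Ext.contravariant_sequence_exact₁ hS W (Ext.mk₀ f₁)
      (n₁ := 1) rfl (ext_coresSet_zero d 𝒰 hrigid (j + 1) S.X₃ W h₃ hW 0 (by lia) _)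
    obtain ⟨h, rfl⟩ := (Ext.mk₀_bijective _ _).2 x
    rw [Ext.mk₀_comp_mk₀] at hx
    have hx := (Ext.mk₀_bijective _ _).1 hx
    let S₂ : ShortComplex A := ShortComplex.mk (biprod.inl : W ⟶ W ⊞ V) biprod.snd (by simp)
    have hS₂ : S₂.ShortExact :=
      (ShortComplex.Splitting.mk (S := S₂) biprod.fst biprod.inr).shortExact
    let φ : S ⟶ S₂ :=
      { τ₁ := f₁
        τ₂ := biprod.lift h (S.g ≫ f₃)
        τ₃ := f₃
        comm₁₂ := by
          apply biprod.hom_ext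
          · simp [S₂, hx]
          · simp [S₂]
        comm₂₃ := by simp [S₂] }
    have : Mono φ.τ₃ := hf₃
    have : Mono φ.τ₁ := hf₁
    have : Mono S.f := hS.mono_f
    have : Mono S₂.f := hS₂.mono_f
    have hm : Mono φ.τ₂ := ShortComplex.mono_τ₂_of_exact_of_mono φ hS.exact
    obtain ⟨T, hT, ⟨e₁⟩, ⟨e₂⟩, ⟨e₃⟩⟩ := cok_ses S S₂ hS hS₂ φ
    refine ⟨W ⊞ V, φ.τ₂, hUadd _ _ hW hV, hm, coresSet_iso 𝒰 j e₂ ?_⟩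
    exact coresSet_ext j (by lia) T hT (coresSet_iso 𝒰 j e₁.symm hc₁)
      (coresSet_iso 𝒰 j e₃.symm hc₃)

lemma coresSet_ker (j : ℕ) (hj : j + 1 ≤ d) (S : ShortComplex A) (hS : S.ShortExact)
    (h₂ : S.X₂ ∈ coresSet A 𝒰 (j + 1)) (h₃ : S.X₃ ∈ coresSet A 𝒰 j) :
    S.X₁ ∈ coresSet A 𝒰 (j + 1) := by
  obtain ⟨V, f, hV, hf, hc⟩ := h₂
  have := hS.mono_f
  have := hS.epi_g
  refine ⟨V, S.f ≫ f, hV, mono_comp _ _, ?_⟩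
  let S₁ : ShortComplex A := ShortComplex.mk (𝟙 S.X₁) (0 : S.X₁ ⟶ ((HasZeroObject.zero' A).zero : A))
    (by simp)
  have z : IsZero ((HasZeroObject.zero' A).zero : A) := isZero_zero A
  have hS₁ : S₁.ShortExact :=
    { exact := (ShortComplex.exact_iff_epi _ rfl).2 (by dsimp [S₁]; infer_instance)
      mono_f := by dsimp [S₁]; infer_instance
      epi_g := ⟨fun _ _ _ => z.eq_of_src _ _⟩ }
  let φ : S₁ ⟶ ShortComplex.mk f (cokernel.π f) (cokernel.condition f) :=
    { τ₁ := S.f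
      τ₂ := S.f ≫ f
      τ₃ := 0
      comm₁₂ := by simp [S₁]
      comm₂₃ := by simp [S₁] }
  have : Mono φ.τ₃ := ⟨fun _ _ _ => z.eq_of_tgt _ _⟩
  obtain ⟨T, hT, ⟨e₁⟩, ⟨e₂⟩, ⟨e₃⟩⟩ := cok_ses S₁ _ hS₁ (cokernelSES f) φ
  refine coresSet_iso 𝒰 j e₂ (coresSet_ext d 𝒰 hUadd hrigid j hj T hT ?_ ?_)
  · refine coresSet_iso 𝒰 j ?_ h₃
    exact (IsColimit.coconePointUniqueUpToIso hS.gIsCokernel (cokernelIsCokernel S.f)) ≪≫ e₁.symm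
  · exact coresSet_iso 𝒰 j (cokernelZeroIsoTarget.symm ≪≫ e₃.symm) hc

end

end CoresAux

/-- if `0 → E₃ → E₂ → E₁ → 0` is a short exact sequence with
`E₂ ∈ 𝒰^d(A)` and `E₁ ∈ 𝒰^{d-1}(A)`, then `E₃ ∈ 𝒰^d(A)`. -/
theorem coresSet_kernel_of_deflation
    (A : Type u) [Category.{v} A] [Abelian A] (d : ℕ) (hd : 2 ≤ d)
    (𝒰 : Set A)
    (hU0 : ∀ Z : A, IsZero Z → Z ∈ 𝒰)
    (hUadd : ∀ X Y : A, X ∈ 𝒰 → Y ∈ 𝒰 → (X ⊞ Y) ∈ 𝒰)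
    (hUiso : ∀ X Y : A, (X ≅ Y) → X ∈ 𝒰 → Y ∈ 𝒰)
    (hrigid : ∀ i, 0 < i → i < d → ∀ U ∈ 𝒰, ∀ U' ∈ 𝒰, extVanish A i U U') :
    ∀ S : ShortComplex A, S.ShortExact →
      S.X₂ ∈ coresSet A 𝒰 d → S.X₃ ∈ coresSet A 𝒰 (d - 1) → S.X₁ ∈ coresSet A 𝒰 d := by
  obtain ⟨j, rfl⟩ : ∃ j, d = j + 1 := ⟨d - 1, by lia⟩
  intro S hS h₂ h₃
  have := HasExt.standard A
  exact CoresAux.coresSet_ker (j + 1) 𝒰 hUadd hrigid j le_rfl S hS h₂ h₃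
end

section
/- Let A be an abelian category, d ≥ 2, and U a d-rigid full additive subcategory of A. Then the subcategory U^d(A) is closed under additive complements in A: if E ∈ A and F ∈ U^d(A) satisfy E ⊕ F ∈ U^d(A), then E ∈ U^d(A). -/
open CategoryTheory CategoryTheory.Limits

universe v u

variable (A : Type u) [Category.{v} A] [Abelian A]

variable {A}

section Helpers

open CategoryTheory Category Limits Abelian

universe w

lemma aux_epi {C : Type u} [Category.{v} C] [Abelian C]
    {P : C} {K : CochainComplex C ℤ} {i : ℤ}
    (π : K ⟶ (HomologicalComplex.single C (ComplexShape.up ℤ) i).obj P)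
    [K.IsStrictlyLE i] [QuasiIsoAt π i] :
    ∃ (α : K.X i ⟶ P) (j : (HomologicalComplex.single C (ComplexShape.up ℤ) i).obj (K.X i) ⟶ K),
      Epi α ∧ j ≫ π = (HomologicalComplex.single C (ComplexShape.up ℤ) i).map α := by
  let e := K.iCyclesIso i (i + 1) (by simp)
    ((K.isZero_of_isStrictlyLE i (i + 1) (by simp)).eq_of_tgt _ _)
  let α := e.inv ≫ K.homologyπ i ≫ HomologicalComplex.homologyMap π i ≫
    (HomologicalComplex.singleObjHomologySelfIso _ _ _).hom
  have h0 : π.f i = α ≫ (HomologicalComplex.singleObjXSelf (ComplexShape.up ℤ) i P).inv := by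
    have he : e.hom = K.iCycles i := rfl
    rw [← cancel_epi e.hom]
    dsimp [α, e]
    rw [assoc, assoc, assoc, Iso.hom_inv_id_assoc,
      HomologicalComplex.homologyπ_naturality_assoc,
      HomologicalComplex.homologyπ_singleObjHomologySelfIso_hom_assoc,
      ← HomologicalComplex.singleObjCyclesSelfIso_inv_iCycles, Iso.hom_inv_id_assoc,
      HomologicalComplex.cyclesMap_i]
    rfl
  refine ⟨α, HomologicalComplex.mkHomFromSingle (c := ComplexShape.up ℤ) (𝟙 (K.X i)) (fun k hk =>
      (K.isZero_of_isStrictlyLE i k (by simp at hk; lia)).eq_of_tgt _ _), ?_, ?_⟩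
  · have h1 : IsIso (HomologicalComplex.homologyMap π i) := inferInstance
    have h2 : Epi (K.homologyπ i) := inferInstance
    have h3 : Epi (HomologicalComplex.homologyMap π i ≫
      (HomologicalComplex.singleObjHomologySelfIso _ _ _).hom) := epi_comp _ _
    have h4 := epi_comp (K.homologyπ i) (HomologicalComplex.homologyMap π i ≫
      (HomologicalComplex.singleObjHomologySelfIso _ _ _).hom)
    exact epi_comp e.inv _
  · apply HomologicalComplex.from_single_hom_ext
    rw [HomologicalComplex.comp_f, HomologicalComplex.mkHomFromSingle_f, assoc, h0, id_comp]
    exact (HomologicalComplex.single_map_f_self _ i α).symm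

lemma efface_Q {C : Type u} [Category.{v} C] [Abelian C] [HasDerivedCategory.{w} C] {X : C}
    {L : CochainComplex C ℤ} {i : ℤ}
    (φ : DerivedCategory.Q.obj ((HomologicalComplex.single C (ComplexShape.up ℤ) i).obj X) ⟶ DerivedCategory.Q.obj L)
    (n : ℤ) (hn : n < i) [L.IsStrictlyLE n] :
    ∃ (P : C) (p : P ⟶ X), Epi p ∧
      DerivedCategory.Q.map ((HomologicalComplex.single C (ComplexShape.up ℤ) i).map p) ≫ φ = 0 := by
  have : CochainComplex.IsStrictlyLE ((HomologicalComplex.single C (ComplexShape.up ℤ) i).obj X) i :=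
    inferInstanceAs (CochainComplex.IsStrictlyLE ((CochainComplex.singleFunctor C i).obj X) i)
  obtain ⟨K, _, π, h, g, rfl⟩ := DerivedCategory.right_fac_of_isStrictlyLE φ i
  have h' := h
  rw [DerivedCategory.isIso_Q_map_iff_quasiIso] at h'
  obtain ⟨α, j, hα, hh⟩ := aux_epi π
  refine ⟨_, α, hα, ?_⟩
  have h2 : j ≫ g = 0 := by
    apply HomologicalComplex.from_single_hom_ext
    apply (L.isZero_of_isStrictlyLE n i hn).eq_of_tgt
  rw [← hh, Functor.map_comp, assoc, IsIso.hom_inv_id_assoc, ← Functor.map_comp, h2,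
    Functor.map_zero]

lemma efface {C : Type u} [Category.{v} C] [Abelian C] [HasExt.{w} C] {X Y : C} {n : ℕ}
    (e : Ext.{w} X Y (n + 1)) : ∃ (P : C) (p : P ⟶ X), Epi p ∧
      (Ext.mk₀ p).comp e (zero_add _) = 0 := by
  let := HasDerivedCategory.standard C
  obtain ⟨P, p, hp, h⟩ := efface_Q 
    (L := (CochainComplex.singleFunctor C (-(n + 1))).obj Y) (i := 0) (X := X) 
    (e.hom ≫ (((DerivedCategory.singleFunctors C).shiftIso (n + 1) (-(n + 1)) 0
    (by lia)).hom.app Y)) (n := -(n + 1)) (by lia)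
  refine ⟨P, p, hp, ?_⟩
  ext
  simp only [Ext.comp_hom, Ext.mk₀_hom, Ext.zero_hom, ShiftedHom.mk₀_comp]
  rw [← cancel_mono (((DerivedCategory.singleFunctors C).shiftIso (n + 1) (-(n + 1)) 0
    (by lia)).hom.app _), zero_comp, assoc]
  exact h

/-- An exact sequence unbounded to the left. -/
structure SeqX (A : Type u) [Category.{v} A] [Abelian A] where
  ob : ℕ → A
  d : ∀ i : ℕ, ob (i + 1) ⟶ ob i
  w : ∀ i, d (i + 1) ≫ d i = 0
  ex : ∀ i, (ShortComplex.mk (d (i + 1)) (d i) (w i)).Exact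

namespace SeqX

variable {A : Type u} [Category.{v} A] [Abelian A]

noncomputable abbrev im (s : SeqX A) (i : ℕ) : A := image (s.d i)

lemma im_w (s : SeqX A) (i : ℕ) : Limits.image.ι (s.d (i + 1)) ≫ factorThruImage (s.d i) = 0 := by
  rw [← cancel_epi (factorThruImage (s.d (i + 1))), ← cancel_mono (Limits.image.ι (s.d i))]
  simp [s.w i]

noncomputable def ses (s : SeqX A) (i : ℕ) : ShortComplex A :=
  ShortComplex.mk (Limits.image.ι (s.d (i + 1))) (factorThruImage (s.d i)) (s.im_w i)

lemma ses_shortExact (s : SeqX A) (i : ℕ) : (s.ses i).ShortExact := by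
  have h1 : Mono (s.ses i).f := inferInstanceAs (Mono (Limits.image.ι (s.d (i + 1))))
  have h2 : Epi (s.ses i).g := inferInstanceAs (Epi (factorThruImage (s.d i)))
  refine ⟨?_⟩
  let φ : ShortComplex.mk (s.d (i + 1)) (s.d i) (s.w i) ⟶
      ShortComplex.mk (Limits.image.ι (s.d (i + 1))) (s.d i)
        (by rw [← cancel_epi (factorThruImage (s.d (i + 1)))]; simp [s.w i]) :=
    { τ₁ := factorThruImage _, τ₂ := 𝟙 _, τ₃ := 𝟙 _ }
  have e1 := (ShortComplex.exact_iff_of_epi_of_isIso_of_mono φ).1 (s.ex i)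
  let ψ : s.ses i ⟶ ShortComplex.mk (Limits.image.ι (s.d (i + 1))) (s.d i)
        (by rw [← cancel_epi (factorThruImage (s.d (i + 1)))]; simp [s.w i]) :=
    { τ₁ := 𝟙 _, τ₂ := 𝟙 _, τ₃ := Limits.image.ι _
      comm₁₂ := by simp [ses]
      comm₂₃ := by simp [ses] }
  have : Epi ψ.τ₁ := inferInstanceAs (Epi (𝟙 _))
  have : IsIso ψ.τ₂ := inferInstanceAs (IsIso (𝟙 _))
  have : Mono ψ.τ₃ := inferInstanceAs (Mono (Limits.image.ι (s.d i)))
  exact (ShortComplex.exact_iff_of_epi_of_isIso_of_mono ψ).2 e1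

noncomputable def e [HasExt.{w} A] (s : SeqX A) (i : ℕ) : Ext.{w} (s.im i) (s.im (i + 1)) 1 :=
  (s.ses_shortExact i).extClass

noncomputable def cls [HasExt.{w} A] (s : SeqX A) : ∀ n : ℕ, Ext.{w} (s.im 0) (s.im n) n
  | 0 => Ext.mk₀ (𝟙 _)
  | n + 1 => (s.cls n).comp (s.e n) rfl

abbrev tail (s : SeqX A) : SeqX A where
  ob i := s.ob (i + 1)
  d i := s.d (i + 1)
  w i := s.w (i + 1)
  ex i := s.ex (i + 1)

lemma cls_tail [HasExt.{w} A] (s : SeqX A) (n : ℕ) :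
    s.cls (n + 1) = (s.e 0).comp (s.tail.cls n) (add_comm _ _) := by
  induction n with
  | zero =>
    change (Ext.mk₀ (𝟙 _)).comp (s.e 0) _ = (s.e 0).comp (Ext.mk₀ (𝟙 _)) _
    rw [Ext.mk₀_id_comp, Ext.comp_mk₀_id]
  | succ n ih =>
    change (s.cls (n + 1)).comp (s.e (n + 1)) _ = 
      (s.e 0).comp ((s.tail.cls n).comp (s.e (n + 1)) rfl) _
    rw [ih]
    exact Ext.comp_assoc (a₂₃ := n + 1) (s.e 0) (s.tail.cls n) (s.tail.e n)
      (add_comm 1 n) rfl (by lia)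

variable {s t : SeqX A} (φ : ∀ i, s.ob i ⟶ t.ob i) (hφ : ∀ i, s.d i ≫ φ i = φ (i + 1) ≫ t.d i)

noncomputable def m (i : ℕ) : s.im i ⟶ t.im i :=
  image.map (Arrow.homMk (f := Arrow.mk (s.d i)) (g := Arrow.mk (t.d i))
    (φ (i + 1)) (φ i) (hφ i).symm)

lemma m_ι (i : ℕ) : m φ hφ i ≫ Limits.image.ι (t.d i) = Limits.image.ι (s.d i) ≫ φ i := by
  exact image.map_ι _

lemma m_ι_assoc (i : ℕ) {Z : A} (h : t.ob i ⟶ Z) :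
    m φ hφ i ≫ Limits.image.ι (t.d i) ≫ h = Limits.image.ι (s.d i) ≫ φ i ≫ h := by
  rw [← assoc, m_ι, assoc]

lemma fac_m (i : ℕ) : factorThruImage (s.d i) ≫ m φ hφ i = φ (i + 1) ≫ factorThruImage (t.d i) := by
  rw [← cancel_mono (Limits.image.ι _), assoc, m_ι, assoc, Limits.image.fac_assoc, Limits.image.fac, hφ]

lemma e_nat [HasExt.{w} A] (i : ℕ) : (s.e i).comp (Ext.mk₀ (m φ hφ (i + 1))) (add_zero 1) =
    (Ext.mk₀ (m φ hφ i)).comp (t.e i) (zero_add 1) := by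
  let f : s.ses i ⟶ t.ses i :=
    { τ₁ := m φ hφ (i + 1), τ₂ := φ (i + 1), τ₃ := m φ hφ i
      comm₁₂ := m_ι φ hφ (i + 1)
      comm₂₃ := (fac_m φ hφ i).symm }
  exact ShortComplex.ShortExact.extClass_naturality (s.ses_shortExact i) (t.ses_shortExact i) f

lemma cls_nat [HasExt.{w} A] (n : ℕ) : (s.cls n).comp (Ext.mk₀ (m φ hφ n)) (add_zero n) =
    (Ext.mk₀ (m φ hφ 0)).comp (t.cls n) (zero_add n) := by
  induction n with
  | zero =>
    change (Ext.mk₀ (𝟙 _)).comp _ _ = Ext.comp _ (Ext.mk₀ (𝟙 _)) _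
    rw [Ext.mk₀_id_comp, Ext.comp_mk₀_id]
  | succ n ih =>
    change ((s.cls n).comp (s.e n) rfl).comp _ _ = Ext.comp _ ((t.cls n).comp (t.e n) rfl) _
    rw [Ext.comp_assoc _ _ _ rfl (add_zero 1) (by lia), e_nat,
      ← Ext.comp_assoc _ _ _ (add_zero n) (zero_add 1) (by lia), ih,
      Ext.comp_assoc _ _ _ (zero_add n) rfl (by lia)]

noncomputable def clsIso [HasExt.{w} A] (s : SeqX A) {X Y : A} (n : ℕ) (a : s.im 0 ≅ X)
    (b : s.im n ≅ Y) : Ext.{w} X Y n :=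
  (Ext.mk₀ a.inv).comp ((s.cls n).comp (Ext.mk₀ b.hom) (add_zero n)) (zero_add n)

lemma clsIso_nat [HasExt.{w} A] {X X' Y : A} (n : ℕ) (a : s.im 0 ≅ X) (b : s.im n ≅ Y)
    (a' : t.im 0 ≅ X') (b' : t.im n ≅ Y) (f : X ⟶ X') (h0 : m φ hφ 0 ≫ a'.hom = a.hom ≫ f)
    (hn : b.inv ≫ m φ hφ n = b'.inv) :
    s.clsIso n a b = (Ext.mk₀ f).comp (t.clsIso n a' b') (zero_add n) := by
  have hn' : b.hom = m φ hφ n ≫ b'.hom := by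
    rw [← cancel_epi b.inv, ← assoc, hn]; simp
  have h0' : f ≫ a'.inv = a.inv ≫ m φ hφ 0 := by
    rw [← cancel_epi a.hom, ← assoc, ← h0]; simp
  have h1 : (s.cls n).comp (Ext.mk₀ b.hom) (add_zero n) =
      (Ext.mk₀ (m φ hφ 0)).comp ((t.cls n).comp (Ext.mk₀ b'.hom) (add_zero n)) (zero_add n) := by
    rw [hn', ← Ext.mk₀_comp_mk₀, ← Ext.comp_assoc _ _ _ (add_zero n) (zero_add 0) (by lia), 
      cls_nat, Ext.comp_assoc _ _ _ (zero_add n) (add_zero n) (by lia)]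
  rw [clsIso, clsIso, h1, Ext.mk₀_comp_mk₀_assoc, Ext.mk₀_comp_mk₀_assoc, h0']

end SeqX

namespace ExtSeq

variable {A : Type u} [Category.{v} A] [Abelian A] {n : ℕ} {X Y : A}

abbrev toSeq (s : ExtSeq A n X Y) : SeqX A where
  ob := s.ob
  d := s.d
  w := s.w
  ex := s.ex

noncomputable def a (s : ExtSeq A n X Y) : s.toSeq.im 0 ≅ X :=
  have := s.epi0
  have : Epi (Limits.image.ι (s.d 0)) := epi_of_epi_fac (Limits.image.fac (s.d 0))
  have : IsIso (Limits.image.ι (s.d 0)) := isIso_of_mono_of_epi _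
  asIso (Limits.image.ι (s.d 0)) ≪≫ s.iso0

lemma a_hom (s : ExtSeq A n X Y) : s.a.hom = Limits.image.ι (s.d 0) ≫ s.iso0.hom := rfl

noncomputable def b (s : ExtSeq A n X Y) : s.toSeq.im n ≅ Y :=
  have : Mono (s.d n) := (s.ex n).mono_g ((s.is_zero (n + 1 + 1) (by lia)).eq_of_src _ _)
  have : Mono (factorThruImage (s.d n)) := mono_of_mono_fac (Limits.image.fac (s.d n))
  have : IsIso (factorThruImage (s.d n)) := isIso_of_mono_of_epi _
  (s.isoTop.symm ≪≫ asIso (factorThruImage (s.d n))).symm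

lemma b_inv (s : ExtSeq A n X Y) : s.b.inv = s.isoTop.inv ≫ factorThruImage (s.d n) := rfl

noncomputable def cl [HasExt.{w} A] (s : ExtSeq A n X Y) : Ext.{w} X Y n :=
  s.toSeq.clsIso n s.a s.b

lemma cl_eq_of_hom [HasExt.{w} A] (s t : ExtSeq A n X Y) (h : ExtSeqHom s t) : 
    (s.cl : Ext.{w} X Y n) = t.cl := by
  have := SeqX.clsIso_nat (s := s.toSeq) (t := t.toSeq) h.φ h.comm n s.a s.b t.a t.b (𝟙 X) (by
    rw [a_hom]
    erw [SeqX.m_ι_assoc]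
    rw [a_hom, h.φ0]; simp) (by
    rw [b_inv, b_inv, assoc]
    have h1 : factorThruImage (s.d n) ≫ SeqX.m (s := s.toSeq) (t := t.toSeq) h.φ h.comm n =
      h.φ (n + 1) ≫ factorThruImage (t.d n) :=
      SeqX.fac_m (s := s.toSeq) (t := t.toSeq) h.φ h.comm n
    rw [h1, h.φTop]; simp)
  rw [Ext.mk₀_id_comp] at this
  exact this

lemma cl_eq_of_equiv [HasExt.{w} A] (s t : ExtSeq A n X Y) (h : YonedaEquiv s t) : 
    (s.cl : Ext.{w} X Y n) = t.cl := by
  induction h with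
  | rel x y h => exact cl_eq_of_hom _ _ h.some
  | refl x => rfl
  | symm x y _ ih => exact ih.symm
  | trans x y z _ _ h1 h2 => exact h1.trans h2

end ExtSeq

namespace ExtSeq

variable {A : Type u} [Category.{v} A] [Abelian A]

/-- Object part of the splice. -/
def spliceOb {n : ℕ} {S : ShortComplex A} {Y : A} (s : ExtSeq A n S.X₁ Y) : ℕ → A
  | 0 => S.X₃
  | 1 => S.X₂
  | i + 2 => s.ob (i + 1)

def spliceD {n : ℕ} {S : ShortComplex A} {Y : A} (s : ExtSeq A n S.X₁ Y) :
    ∀ i, s.spliceOb (i + 1) ⟶ s.spliceOb i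
  | 0 => S.g
  | 1 => s.d 0 ≫ s.iso0.hom ≫ S.f
  | i + 2 => s.d (i + 1)

lemma splice_w {n : ℕ} {S : ShortComplex A} {Y : A} (s : ExtSeq A n S.X₁ Y) :
    ∀ i, s.spliceD (i + 1) ≫ s.spliceD i = 0
  | 0 => by
    change (s.d 0 ≫ s.iso0.hom ≫ S.f) ≫ S.g = 0
    simp
  | 1 => by
    change s.d 1 ≫ s.d 0 ≫ s.iso0.hom ≫ S.f = 0
    rw [← assoc, s.w 0, zero_comp]
  | i + 2 => s.w (i + 1)

lemma splice_ex {n : ℕ} {S : ShortComplex A} (hS : S.ShortExact) {Y : A} (s : ExtSeq A n S.X₁ Y) :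
    ∀ i, (ShortComplex.mk (s.spliceD (i + 1)) (s.spliceD i) (s.splice_w i)).Exact
  | 0 => by
    have := s.epi0
    let φ : ShortComplex.mk (s.spliceD (0 + 1)) (s.spliceD 0) (s.splice_w 0) ⟶ S :=
      { τ₁ := s.d 0 ≫ s.iso0.hom, τ₂ := 𝟙 S.X₂, τ₃ := 𝟙 S.X₃
        comm₁₂ := by
          change (s.d 0 ≫ s.iso0.hom) ≫ S.f = (s.d 0 ≫ s.iso0.hom ≫ S.f) ≫ 𝟙 S.X₂
          simp
        comm₂₃ := by
          change 𝟙 S.X₂ ≫ S.g = S.g ≫ 𝟙 S.X₃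
          simp }
    have h1 : Epi φ.τ₁ := epi_comp (s.d 0) s.iso0.hom
    have h2 : IsIso φ.τ₂ := inferInstanceAs (IsIso (𝟙 S.X₂))
    have h3 : Mono φ.τ₃ := inferInstanceAs (Mono (𝟙 S.X₃))
    exact (ShortComplex.exact_iff_of_epi_of_isIso_of_mono φ).2 hS.exact
  | 1 => by
    have := hS.mono_f
    let φ : ShortComplex.mk (s.d 1) (s.d 0) (s.w 0) ⟶
        ShortComplex.mk (s.spliceD (1 + 1)) (s.spliceD 1) (s.splice_w 1) :=
      { τ₁ := 𝟙 (s.ob 2), τ₂ := 𝟙 (s.ob 1), τ₃ := s.iso0.hom ≫ S.f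
        comm₁₂ := by
          change 𝟙 (s.ob 2) ≫ s.d 1 = s.d 1 ≫ 𝟙 (s.ob 1)
          simp
        comm₂₃ := by
          change 𝟙 (s.ob 1) ≫ (s.d 0 ≫ s.iso0.hom ≫ S.f) = s.d 0 ≫ s.iso0.hom ≫ S.f
          simp }
    have h1 : Epi φ.τ₁ := inferInstanceAs (Epi (𝟙 (s.ob 2)))
    have h2 : IsIso φ.τ₂ := inferInstanceAs (IsIso (𝟙 (s.ob 1)))
    have h3 : Mono φ.τ₃ := mono_comp s.iso0.hom S.f
    exact (ShortComplex.exact_iff_of_epi_of_isIso_of_mono φ).1 (s.ex 0)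
  | i + 2 => s.ex (i + 1)

def splice {n : ℕ} {S : ShortComplex A} (hS : S.ShortExact) {Y : A} (s : ExtSeq A n S.X₁ Y) :
    ExtSeq A (n + 1) S.X₃ Y where
  ob := s.spliceOb
  d := s.spliceD
  iso0 := Iso.refl _
  isoTop := s.isoTop
  is_zero
    | 0, h => by lia
    | 1, h => by lia
    | i + 2, h => s.is_zero (i + 1) (by lia)
  w := s.splice_w
  ex := s.splice_ex hS
  epi0 := hS.epi_g

/-- The comparison morphism to the tail of the splice. -/
def spliceφ {n : ℕ} {S : ShortComplex A} (hS : S.ShortExact) {Y : A} (s : ExtSeq A n S.X₁ Y) :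
    ∀ i, s.toSeq.ob i ⟶ (s.splice hS).toSeq.tail.ob i
  | 0 => s.iso0.hom ≫ S.f
  | i + 1 => 𝟙 (s.ob (i + 1))

lemma spliceφ_comm {n : ℕ} {S : ShortComplex A} (hS : S.ShortExact) {Y : A}
    (s : ExtSeq A n S.X₁ Y) : ∀ i, s.toSeq.d i ≫ s.spliceφ hS i =
      s.spliceφ hS (i + 1) ≫ (s.splice hS).toSeq.tail.d i
  | 0 => by
    change s.d 0 ≫ s.iso0.hom ≫ S.f = 𝟙 (s.ob 1) ≫ (s.d 0 ≫ s.iso0.hom ≫ S.f)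
    simp
  | i + 1 => by
    change s.d (i + 1) ≫ 𝟙 (s.ob (i + 1)) = 𝟙 (s.ob (i + 2)) ≫ s.d (i + 1)
    simp

lemma assoc_aux [HasExt.{w} A] {n : ℕ} {X I J K Y Z : A} (ai : X ⟶ I) (e : Ext.{w} I J 1)
    (c : Ext.{w} J K n) (b : K ⟶ Y) (h : J ⟶ Z) (k : Z ⟶ J) (hk : h ≫ k = 𝟙 J) :
    (Ext.mk₀ ai).comp ((e.comp c (add_comm 1 n)).comp (Ext.mk₀ b) (add_zero (n + 1)))
      (zero_add (n + 1)) =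
    ((Ext.mk₀ ai).comp (e.comp (Ext.mk₀ h) (add_zero 1)) (zero_add 1)).comp
      ((Ext.mk₀ k).comp (c.comp (Ext.mk₀ b) (add_zero n)) (zero_add n)) (add_comm 1 n) := by
  rw [Ext.comp_assoc (a₂₃ := n + 1) _ _ _ (zero_add 1) (add_comm 1 n) (by lia),
    Ext.comp_assoc (a₂₃ := n) _ _ _ (add_zero 1) (zero_add n) (by lia),
    Ext.mk₀_comp_mk₀_assoc, hk, Ext.mk₀_id_comp,
    Ext.comp_assoc (a₂₃ := n) _ _ _ (add_comm 1 n) (add_zero n) (by lia)]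

lemma cl_splice [HasExt.{w} A] {n : ℕ} {S : ShortComplex A} (hS : S.ShortExact) {Y : A}
    (s : ExtSeq A n S.X₁ Y) :
    ((s.splice hS).cl : Ext.{w} S.X₃ Y (n + 1)) = hS.extClass.comp s.cl (add_comm 1 n) := by
  let t := s.splice hS
  let T := t.toSeq.tail
  have hf := hS.mono_f
  have hm_ι : SeqX.m _ (s.spliceφ_comm hS) 0 ≫ Limits.image.ι (t.d 1) =
      Limits.image.ι (s.d 0) ≫ s.iso0.hom ≫ S.f := SeqX.m_ι _ (s.spliceφ_comm hS) 0
  have hmono : Mono (SeqX.m _ (s.spliceφ_comm hS) 0) := by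
    have : Mono (SeqX.m _ (s.spliceφ_comm hS) 0 ≫ Limits.image.ι (t.d 1)) := by
      rw [hm_ι]
      have := mono_comp s.iso0.hom S.f
      exact @mono_comp A _ _ _ _ (Limits.image.ι (s.d 0)) inferInstance _ this
    exact mono_of_mono _ (Limits.image.ι (t.d 1))
  have hfac : factorThruImage (s.d 0) ≫ SeqX.m _ (s.spliceφ_comm hS) 0 =
      factorThruImage (t.d 1) := (SeqX.fac_m _ (s.spliceφ_comm hS) 0).trans (id_comp _)
  have hepi : Epi (SeqX.m _ (s.spliceφ_comm hS) 0) := by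
    have : Epi (factorThruImage (s.d 0) ≫ SeqX.m _ (s.spliceφ_comm hS) 0) := by
      rw [hfac]
      exact inferInstanceAs (Epi (factorThruImage (t.d 1)))
    exact epi_of_epi (factorThruImage (s.d 0)) _
  have hiso : IsIso (SeqX.m _ (s.spliceφ_comm hS) 0) := isIso_of_mono_of_epi _
  let a' : T.im 0 ≅ S.X₁ := (asIso (SeqX.m _ (s.spliceφ_comm hS) 0)).symm ≪≫ s.a
  have hb : s.b.inv ≫ SeqX.m _ (s.spliceφ_comm hS) n = t.b.inv := by
    have h1 : factorThruImage (s.d n) ≫ SeqX.m _ (s.spliceφ_comm hS) n =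
      factorThruImage (t.d (n + 1)) := (SeqX.fac_m _ (s.spliceφ_comm hS) n).trans (id_comp _)
    rw [b_inv, b_inv, assoc]
    exact congrArg (s.isoTop.inv ≫ ·) h1
  have h1 := SeqX.clsIso_nat (s := s.toSeq) (t := T) _ (s.spliceφ_comm hS) n s.a s.b a' t.b (𝟙 _)
    (by simp [a']) hb
  rw [Ext.mk₀_id_comp] at h1
  have h2 : s.cl = T.clsIso n a' t.b := h1
  rw [h2]
  -- the first short exact sequence
  let f : t.toSeq.ses 0 ⟶ S :=
    { τ₁ := a'.hom, τ₂ := 𝟙 S.X₂, τ₃ := t.a.hom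
      comm₁₂ := by
        have : a'.hom ≫ S.f = Limits.image.ι (t.d 1) := by
          simp only [a', Iso.trans_hom, Iso.symm_hom, asIso_inv, assoc]
          refine (IsIso.inv_comp_eq _).2 ?_
          refine Eq.trans ?_ hm_ι.symm
          rw [a_hom, assoc]
        exact this.trans (comp_id _).symm
      comm₂₃ := by
        change 𝟙 S.X₂ ≫ S.g = factorThruImage (t.d 0) ≫ Limits.image.ι (t.d 0) ≫ t.iso0.hom
        rw [Limits.image.fac_assoc]
        exact (id_comp S.g).trans (comp_id S.g).symm }
  have h3 : (t.toSeq.e 0).comp (Ext.mk₀ a'.hom) (add_zero 1) =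
      (Ext.mk₀ t.a.hom).comp hS.extClass (zero_add 1) :=
    ShortComplex.ShortExact.extClass_naturality (t.toSeq.ses_shortExact 0) hS f
  have h4 : hS.extClass = (Ext.mk₀ t.a.inv).comp ((t.toSeq.e 0).comp (Ext.mk₀ a'.hom)
      (add_zero 1)) (zero_add 1) := by
    rw [h3, Ext.mk₀_comp_mk₀_assoc, Iso.inv_hom_id, Ext.mk₀_id_comp]
  change t.toSeq.clsIso (n + 1) t.a t.b = _
  rw [SeqX.clsIso, SeqX.cls_tail, SeqX.clsIso, h4]
  exact assoc_aux _ _ _ _ _ _ (Iso.hom_inv_id a')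

open scoped ZeroObject in
noncomputable def triv (Y : A) : ExtSeq A 0 Y Y where
  ob
    | 0 => Y
    | 1 => Y
    | _ + 2 => 0
  d
    | 0 => 𝟙 Y
    | 1 => 0
    | _ + 2 => 0
  iso0 := Iso.refl _
  isoTop := Iso.refl _
  is_zero
    | 0, h => by lia
    | 1, h => by lia
    | i + 2, h => isZero_zero A
  w
    | 0 => zero_comp
    | 1 => zero_comp
    | i + 2 => zero_comp
  ex
    | 0 => (ShortComplex.exact_iff_mono _ rfl).2 (inferInstanceAs (Mono (𝟙 Y)))
    | 1 => ShortComplex.exact_of_isZero_X₂ _ (isZero_zero A)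
    | i + 2 => ShortComplex.exact_of_isZero_X₂ _ (isZero_zero A)
  epi0 := inferInstanceAs (Epi (𝟙 Y))

lemma cl_triv [HasExt.{w} A] (Y : A) : ((triv Y).cl : Ext.{w} Y Y 0) = Ext.mk₀ (𝟙 Y) := by
  have h : (triv Y).b.inv ≫ (triv Y).a.hom = 𝟙 Y := by
    rw [b_inv, a_hom, assoc]
    rw [Limits.image.fac_assoc]
    exact (id_comp _).trans (comp_id _)
  have h' : (triv Y).a.inv ≫ (triv Y).b.hom = 𝟙 Y := by
    have h2 : (triv Y).a.hom = (triv Y).b.hom :=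
      ((Iso.inv_comp_eq _).1 h).trans (comp_id _)
    rw [← h2, Iso.inv_hom_id]
  change (Ext.mk₀ (triv Y).a.inv).comp ((Ext.mk₀ (𝟙 _)).comp (Ext.mk₀ (triv Y).b.hom)
    (add_zero 0)) (zero_add 0) = _
  rw [Ext.mk₀_id_comp, Ext.mk₀_comp_mk₀, h']

end ExtSeq

lemma pushout_ses {A : Type u} [Category.{v} A] [Abelian A] [HasExt.{w} A]
    {S : ShortComplex A} (hS : S.ShortExact) {Y : A} (g : S.X₁ ⟶ Y) :
    ∃ (P : A) (i : Y ⟶ P) (p : P ⟶ S.X₃) (hw : i ≫ p = 0)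
      (h : (ShortComplex.mk i p hw).ShortExact),
      (h.extClass : Ext.{w} S.X₃ Y 1) = hS.extClass.comp (Ext.mk₀ g) (add_zero 1) := by
  have := hS.mono_f
  have := hS.epi_g
  let p : pushout S.f g ⟶ S.X₃ := pushout.desc S.g 0 (by simp)
  have hp : pushout.inl S.f g ≫ p = S.g := pushout.inl_desc _ _ _
  have hw : pushout.inr S.f g ≫ p = 0 := pushout.inr_desc _ _ _
  have hepi : Epi p := epi_of_epi_fac hp
  have h : (ShortComplex.mk (pushout.inr S.f g) p hw).ShortExact := by
    have : Mono (pushout.inr S.f g) := inferInstance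
    refine ⟨ShortComplex.exact_of_g_is_cokernel _ ?_⟩
    refine CokernelCofork.IsColimit.ofπ p hw (fun {T} k hk => hS.exact.desc (pushout.inl S.f g ≫ k)
      (by rw [pushout.condition_assoc, hk, comp_zero])) ?_ ?_
    · intro T k hk
      apply pushout.hom_ext
      · rw [← assoc, hp]; exact hS.exact.g_desc _ _
      · rw [← assoc, hw, zero_comp]; exact hk.symm
    · intro T k hk m hm
      rw [← cancel_epi p, hm]
      apply pushout.hom_ext
      · rw [← assoc, hp]; exact (hS.exact.g_desc _ _).symm
      · rw [← assoc, hw, zero_comp]; exact hk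
  refine ⟨_, pushout.inr S.f g, p, hw, h, ?_⟩
  let f : S ⟶ ShortComplex.mk (pushout.inr S.f g) p hw :=
    { τ₁ := g, τ₂ := pushout.inl S.f g, τ₃ := 𝟙 _
      comm₁₂ := pushout.condition.symm
      comm₂₃ := by rw [comp_id]; exact hp }
  have := ShortComplex.ShortExact.extClass_naturality hS h f
  exact ((Ext.mk₀_id_comp _).symm.trans this.symm)

lemma realize {A : Type u} [Category.{v} A] [Abelian A] [HasExt.{w} A] (n : ℕ) :
    ∀ {X Y : A} (x : Ext.{w} X Y (n + 1)), ∃ s : ExtSeq A (n + 1) X Y, s.cl = x := by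
  induction n with
  | zero =>
    intro X Y x
    obtain ⟨P, p, hp, hx⟩ := efface x
    let S := ShortComplex.mk _ _ (kernel.condition p)
    have hS : S.ShortExact := { exact := ShortComplex.exact_kernel p }
    obtain ⟨y, rfl⟩ := Ext.contravariant_sequence_exact₃ hS _ x hx (n₀ := 0) rfl
    obtain ⟨g, rfl⟩ := Ext.homEquiv₀.symm.surjective y
    obtain ⟨P', i, q, hw, h, he⟩ := pushout_ses hS g
    refine ⟨(ExtSeq.triv Y).splice h, ?_⟩
    rw [ExtSeq.cl_splice, ExtSeq.cl_triv, Ext.comp_mk₀_id, he]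
    rfl
  | succ n ih =>
    intro X Y x
    obtain ⟨P, p, hp, hx⟩ := efface x
    let S := ShortComplex.mk _ _ (kernel.condition p)
    have hS : S.ShortExact := { exact := ShortComplex.exact_kernel p }
    obtain ⟨y, rfl⟩ := Ext.contravariant_sequence_exact₃ hS _ x hx (n₀ := n + 1) (by lia)
    obtain ⟨s, rfl⟩ := ih y
    exact ⟨s.splice hS, s.cl_splice hS⟩

lemma ext_zero_of_extVanish {A : Type u} [Category.{v} A] [Abelian A] [HasExt.{w} A] {n : ℕ}
    (hn : 0 < n) {X Y : A} (h : extVanish A n X Y) (x : Ext.{w} X Y n) : x = 0 := by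
  obtain ⟨n, rfl⟩ : ∃ m, n = m + 1 := ⟨n - 1, by lia⟩
  obtain ⟨s, rfl⟩ := realize n x
  obtain ⟨t, ht⟩ := realize n (0 : Ext.{w} X Y (n + 1))
  rw [← ht]
  exact ExtSeq.cl_eq_of_equiv _ _ (h s t)

section Cores

variable {A : Type u} [Category.{v} A] [Abelian A] {𝒰 : Set A}

lemma coresSet_iso (j : ℕ) : ∀ {E E' : A}, (E ≅ E') → E ∈ coresSet A 𝒰 j → E' ∈ coresSet A 𝒰 j := by
  cases j with
  | zero => intro E E' e h; exact IsZero.of_iso h e.symm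
  | succ j =>
    rintro E E' e ⟨V, f, hV, hf, hc⟩
    refine ⟨V, e.inv ≫ f, hV, mono_comp _ _, ?_⟩
    have key : ∀ {K K' : A}, (K ≅ K') → K ∈ coresSet A 𝒰 j → K' ∈ coresSet A 𝒰 j :=
      coresSet_iso j
    exact key (cokernelEpiComp e.inv f).symm hc

noncomputable def cokBiprod {X X' Y Y' : A} (f : X ⟶ Y) (g : X' ⟶ Y') :
    cokernel (biprod.map f g) ≅ cokernel f ⊞ cokernel g where
  hom := cokernel.desc _ (biprod.map (cokernel.π f) (cokernel.π g)) (by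
    apply biprod.hom_ext <;> simp)
  inv := biprod.desc (cokernel.desc f (biprod.inl ≫ cokernel.π (biprod.map f g)) (by
      rw [← biprod.inl_map_assoc, cokernel.condition, comp_zero]))
    (cokernel.desc g (biprod.inr ≫ cokernel.π (biprod.map f g)) (by
      rw [← biprod.inr_map_assoc, cokernel.condition, comp_zero]))
  hom_inv_id := by
    ext <;> simp
  inv_hom_id := by
    apply biprod.hom_ext' <;> apply (cancel_epi (cokernel.π _)).1 <;> simp

noncomputable def cokInl {X Y : A} (f : X ⟶ Y) (V : A) :
    cokernel (f ≫ (biprod.inl : Y ⟶ Y ⊞ V)) ≅ cokernel f ⊞ V where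
  hom := cokernel.desc _ (biprod.map (cokernel.π f) (𝟙 V)) (by simp)
  inv := biprod.desc (cokernel.desc f (biprod.inl ≫ cokernel.π _) (by
      rw [← assoc, cokernel.condition]))
    (biprod.inr ≫ cokernel.π _)
  hom_inv_id := by
    ext <;> simp
  inv_hom_id := by
    apply biprod.hom_ext'
    · apply (cancel_epi (cokernel.π _)).1; simp
    · simp

lemma coresSet_one (hUiso : ∀ X Y : A, (X ≅ Y) → X ∈ 𝒰 → Y ∈ 𝒰) {E : A}
    (h : E ∈ coresSet A 𝒰 1) : E ∈ 𝒰 := by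
  obtain ⟨V, f, hV, hf, hc⟩ := h
  have : Epi f := Preadditive.epi_of_isZero_cokernel f hc
  have := isIso_of_mono_of_epi f
  exact hUiso _ _ (asIso f).symm hV

lemma coresSet_biprod (hUadd : ∀ X Y : A, X ∈ 𝒰 → Y ∈ 𝒰 → (X ⊞ Y) ∈ 𝒰) {j : ℕ} {E V : A}
    (h : E ∈ coresSet A 𝒰 (j + 1)) (hV : V ∈ 𝒰) : (E ⊞ V) ∈ coresSet A 𝒰 (j + 1) := by
  obtain ⟨W, f, hW, hf, hc⟩ := h
  refine ⟨W ⊞ V, biprod.map f (𝟙 V), hUadd _ _ hW hV, inferInstance, ?_⟩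
  have hz : IsZero (cokernel (𝟙 V)) := IsZero.of_iso (isZero_zero A) (cokernel.ofEpi (𝟙 V))
  exact coresSet_iso j (isoBiprodZero hz ≪≫ (cokBiprod f (𝟙 V)).symm) hc

lemma ses_coker {X Y : A} (f : X ⟶ Y) [Mono f] :
    (ShortComplex.mk f (cokernel.π f) (cokernel.condition f)).ShortExact where
  exact := ShortComplex.exact_cokernel f

lemma coresSet_ext_zero [HasExt.{w} A] {d : ℕ}
    (hrigid : ∀ i, 0 < i → i < d → ∀ U ∈ 𝒰, ∀ U' ∈ 𝒰, extVanish A i U U') (j : ℕ) :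
    ∀ (K : A), K ∈ coresSet A 𝒰 j → ∀ (i : ℕ), 0 < i → i + j ≤ d → ∀ U ∈ 𝒰,
      ∀ x : Ext.{w} K U i, x = 0 := by
  induction j with
  | zero =>
    intro K hK i hi hij U hU x
    have h : 𝟙 K = 0 := IsZero.eq_of_src hK _ _
    rw [← Ext.mk₀_id_comp x, h, Ext.mk₀_zero, Ext.zero_comp]
  | succ j ih =>
    rintro K ⟨V, f, hV, hf, hc⟩ i hi hij U hU x
    obtain ⟨y, hy⟩ := Ext.contravariant_sequence_exact₁ (ses_coker f) _ x (add_comm 1 i)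
      (ih _ hc (i + 1) (by lia) (by lia) U hU _)
    rw [← hy, ext_zero_of_extVanish hi (hrigid i hi (by lia) V hV U hU) y, Ext.comp_zero]

lemma coresSet_factor {d : ℕ}
    (hrigid : ∀ i, 0 < i → i < d → ∀ U ∈ 𝒰, ∀ U' ∈ 𝒰, extVanish A i U U') {j : ℕ} (hj : j + 1 ≤ d)
    {E V : A} (f : E ⟶ V) [Mono f] (hc : cokernel f ∈ coresSet A 𝒰 j) {U : A} (hU : U ∈ 𝒰)
    (k : E ⟶ U) : ∃ h : V ⟶ U, f ≫ h = k := by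
  have := HasExt.standard A
  obtain ⟨y, hy⟩ := Ext.contravariant_sequence_exact₁ (ses_coker f) _ (Ext.mk₀ k) (add_zero 1)
    (coresSet_ext_zero hrigid j _ hc 1 (by lia) (by lia) U hU _)
  obtain ⟨h, rfl⟩ := (Ext.mk₀_bijective _ _).2 y
  refine ⟨h, ?_⟩
  rw [Ext.mk₀_comp_mk₀] at hy
  exact (Ext.mk₀_bijective _ _).1 hy

lemma coresSet_compl {d : ℕ}
    (hUadd : ∀ X Y : A, X ∈ 𝒰 → Y ∈ 𝒰 → (X ⊞ Y) ∈ 𝒰)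
    (hUiso : ∀ X Y : A, (X ≅ Y) → X ∈ 𝒰 → Y ∈ 𝒰)
    (hrigid : ∀ i, 0 < i → i < d → ∀ U ∈ 𝒰, ∀ U' ∈ 𝒰, extVanish A i U U') (j : ℕ) :
    j + 2 ≤ d → ∀ E F : A, F ∈ coresSet A 𝒰 (j + 2) → (E ⊞ F) ∈ coresSet A 𝒰 (j + 2) →
      E ∈ coresSet A 𝒰 (j + 2) := by
  have step : ∀ (j : ℕ), j + 2 ≤ d → ∀ E F : A, F ∈ coresSet A 𝒰 (j + 2) →
      (E ⊞ F) ∈ coresSet A 𝒰 (j + 2) → ∃ (W : A) (u : E ⟶ W) (G : A), W ∈ 𝒰 ∧ Mono u ∧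
        G ∈ coresSet A 𝒰 (j + 1) ∧ (cokernel u ⊞ G) ∈ coresSet A 𝒰 (j + 1) := by
    rintro j hj E F ⟨V, v, hV, hv, hG⟩ ⟨W, w, hW, hw, hC⟩
    obtain ⟨h, hh⟩ := coresSet_factor hrigid (by lia) w hC hV (biprod.snd ≫ v)
    obtain ⟨g, hg⟩ := coresSet_factor hrigid (by lia) v hG hW (biprod.inr ≫ w)
    refine ⟨W, biprod.inl ≫ w, cokernel v, hW, mono_comp _ _, hG, ?_⟩
    have hgh : v ≫ g ≫ h = v := by rw [← assoc, hg, assoc, hh, biprod.inr_snd_assoc]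
    let θ : W ⊞ V ≅ W ⊞ V := Biprod.unipotentLower g ≪≫ Biprod.unipotentUpper (-h)
    have hθ : biprod.map (biprod.inl ≫ w) v ≫ θ.hom = w ≫ biprod.inl := by
      apply biprod.hom_ext'
      · apply biprod.hom_ext <;> simp [θ, Biprod.ofComponents, hh]
      · apply biprod.hom_ext <;> simp [θ, Biprod.ofComponents, hg, hgh]
    let e : cokernel w ⊞ V ≅ cokernel (biprod.inl ≫ w) ⊞ cokernel v :=
      (cokInl w V).symm ≪≫ cokernelIsoOfEq hθ.symm ≪≫ cokernelCompIsIso _ θ.hom ≪≫ cokBiprod _ _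
    exact coresSet_iso _ e (coresSet_biprod hUadd hC hV)
  induction j with
  | zero =>
    intro hj E F hF hEF
    obtain ⟨W, u, G, hW, hu, hG, hC⟩ := step 0 hj E F hF hEF
    exact ⟨W ⊞ G, u ≫ biprod.inl, hUadd _ _ hW (coresSet_one hUiso hG), mono_comp _ _,
      coresSet_iso _ (cokInl u G).symm hC⟩
  | succ j ih =>
    intro hj E F hF hEF
    obtain ⟨W, u, G, hW, hu, hG, hC⟩ := step (j + 1) hj E F hF hEF
    exact ⟨W, u, hW, hu, ih (by lia) _ G hG hC⟩

end Cores

end Helpers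

/-- for `d ≥ 2`, the subcategory `𝒰^d(A)` is closed under additive
complements in `A`. -/
theorem coresSet_closed_under_additive_complements
    (A : Type u) [Category.{v} A] [Abelian A] (d : ℕ) (hd : 2 ≤ d)
    (𝒰 : Set A)
    (hU0 : ∀ Z : A, IsZero Z → Z ∈ 𝒰)
    (hUadd : ∀ X Y : A, X ∈ 𝒰 → Y ∈ 𝒰 → (X ⊞ Y) ∈ 𝒰)
    (hUiso : ∀ X Y : A, (X ≅ Y) → X ∈ 𝒰 → Y ∈ 𝒰)
    (hrigid : ∀ i, 0 < i → i < d → ∀ U ∈ 𝒰, ∀ U' ∈ 𝒰, extVanish A i U U') :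
    ∀ E F : A, F ∈ coresSet A 𝒰 d → (E ⊞ F) ∈ coresSet A 𝒰 d → E ∈ coresSet A 𝒰 d := by
  obtain ⟨j, rfl⟩ : ∃ j, d = j + 2 := ⟨d - 2, by lia⟩
  exact coresSet_compl hUadd hUiso hrigid j le_rfl
end

section
/- Let A be an abelian category and U a d-rigid full additive subcategory closed under direct summands such that every object E ∈ A admits an exact sequence 0 → E → U^1 → ⋯ → U^d → 0 with U^i ∈ U but without assuming U is closed under direct summands initially; assume instead only that U is closed under additive complements. Then U is closed under direct summands. -/
open CategoryTheory CategoryTheory.Limits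

universe v u

variable (A : Type u) [Category.{v} A] [Abelian A]

variable {A}

namespace YExt
section
open Abelian DerivedCategory HomologicalComplex
variable {C : Type u} [Category.{v} C] [Abelian C]

lemma epi_of_quasiIso (K : CochainComplex C ℤ) [K.IsStrictlyLE 0] (X : C)
    (s : K ⟶ (single C (ComplexShape.up ℤ) 0).obj X) (hs : QuasiIso s) : Epi (s.f 0) := by
  have h1 : IsIso (K.iCycles 0) :=
    K.isIso_iCycles 0 1 (by simp) ((K.isZero_of_isStrictlyLE 0 1 (by lia)).eq_of_tgt _ _)
  let L := (single C (ComplexShape.up ℤ) 0).obj X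
  have h2 : IsIso (L.iCycles 0) := L.isIso_iCycles 0 1 (by simp) (by simp [L])
  have h3 : IsIso (L.homologyπ 0) := L.isIso_homologyπ (-1) 0 (by simp) (by simp [L])
  have h4 : IsIso (homologyMap s 0) := inferInstance
  have e1 : cyclesMap s 0 = K.homologyπ 0 ≫ homologyMap s 0 ≫ inv (L.homologyπ 0) := by
    rw [← cancel_mono (L.homologyπ 0)]
    simp [L]
  have e2 : Epi (cyclesMap s 0) := by rw [e1]; infer_instance
  have e3 : K.iCycles 0 ≫ s.f 0 = cyclesMap s 0 ≫ L.iCycles 0 := by simp [L]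
  have e4 : Epi (K.iCycles 0 ≫ s.f 0) := by rw [e3]; infer_instance
  exact epi_of_epi (K.iCycles 0) _

lemma exists_efface [HasDerivedCategory.{max u v} C] {X Y : C} (n : ℤ) (hn : 0 < n)
    (e : (singleFunctor C 0).obj X ⟶ (singleFunctor C (-n)).obj Y) :
    ∃ (P : C) (p : P ⟶ X), Epi p ∧ (singleFunctor C 0).map p ≫ e = 0 := by
  let L := (CochainComplex.singleFunctor C 0).obj X
  let M := (CochainComplex.singleFunctor C (-n)).obj Y
  let e' : Q.obj L ⟶ Q.obj M := e
  obtain ⟨K, _, s, hs, g, hfac⟩ := right_fac_of_isStrictlyLE e' 0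
  have hs' : QuasiIso s := by rwa [isIso_Q_map_iff_quasiIso] at hs
  have hepi := epi_of_quasiIso K X s hs'
  let i : (CochainComplex.singleFunctor C 0).obj (K.X 0) ⟶ K :=
    mkHomFromSingle (𝟙 _) (fun j hj => (K.isZero_of_isStrictlyLE 0 j (by
      simp at hj; lia)).eq_of_tgt _ _)
  let p : K.X 0 ⟶ X := s.f 0 ≫ (singleObjXSelf (ComplexShape.up ℤ) 0 X).hom
  have hi : i ≫ s = (CochainComplex.singleFunctor C 0).map p := by
    apply from_single_hom_ext
    change i.f 0 ≫ s.f 0 = ((single C (ComplexShape.up ℤ) 0).map p).f 0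
    rw [mkHomFromSingle_f, single_map_f_self]
    have h1 : (s.f 0 ≫ (singleObjXSelf (ComplexShape.up ℤ) 0 X).hom) ≫
        (singleObjXSelf (ComplexShape.up ℤ) 0 X).inv = s.f 0 := by
      have h0 : ∀ {a b c : C} (x : a ⟶ b) (j : b ≅ c), (x ≫ j.hom) ≫ j.inv = x := by simp
      exact h0 _ _
    have h2 : ∀ q : K.X 0 ⟶ L.X 0, q = s.f 0 →
        ((singleObjXSelf (ComplexShape.up ℤ) 0 (K.X 0)).hom ≫ 𝟙 (K.X 0)) ≫ s.f 0 =
        (singleObjXSelf (ComplexShape.up ℤ) 0 (K.X 0)).hom ≫ q := by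
      rintro q rfl
      rw [Category.comp_id]
    exact h2 _ h1
  have hig : i ≫ g = 0 := by
    apply from_single_hom_ext
    exact (isZero_single_obj_X (ComplexShape.up ℤ) (-n) Y 0 (by lia)).eq_of_tgt _ _
  refine ⟨K.X 0, p, @epi_comp _ _ _ _ _ _ hepi _ inferInstance, ?_⟩
  change Q.map ((CochainComplex.singleFunctor C 0).map p) ≫ e' = 0
  rw [← hi, hfac, Q.map_comp]
  rw [Category.assoc, IsIso.hom_inv_id_assoc, ← Q.map_comp, hig, Q.map_zero]

attribute [local instance] HasExt.standard

lemma ext_efface {X Y : C} (n : ℕ) (e : Ext.{max u v} X Y (n+1)) :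
    ∃ (P : C) (p : P ⟶ X), Epi p ∧ (Ext.mk₀ p).comp e (zero_add _) = 0 := by
  let := HasDerivedCategory.standard C
  let iso := ((singleFunctors C).shiftIso ((n+1:ℕ):ℤ) (-((n+1:ℕ):ℤ)) 0 (by lia)).app Y
  obtain ⟨P, p, hp, h⟩ := exists_efface (Y := Y) ((n+1 : ℕ) : ℤ) (by lia) (e.hom ≫ iso.hom)
  refine ⟨P, p, hp, ?_⟩
  ext
  rw [← Ext.singleFunctor_map_comp_hom, Ext.zero_hom, ← cancel_mono iso.hom, Category.assoc, h]
  exact zero_comp.symm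
end

section
open Abelian
variable {C : Type u} [Category.{v} C] [Abelian C]
attribute [local instance] HasExt.standard

/-- tail of an extension -/
noncomputable def tail {n : ℕ} {X Y : C} (s : ExtSeq C (n+1) X Y) :
    ExtSeq C n (kernel (s.d 0)) Y where
  ob := fun | 0 => kernel (s.d 0) | k+1 => s.ob (k+2)
  d := fun | 0 => kernel.lift (s.d 0) (s.d 1) (s.w 0) | k+1 => s.d (k+2)
  iso0 := Iso.refl _
  isoTop := s.isoTop
  is_zero := by
    intro i hi
    cases i with
    | zero => lia
    | succ k => exact s.is_zero (k+2) (by lia)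
  w := by
    intro i
    cases i with
    | zero =>
      rw [← cancel_mono (kernel.ι (s.d 0))]
      simpa using s.w 1
    | succ k => exact s.w (k+2)
  ex := by
    intro i
    cases i with
    | zero =>
      have h := s.ex 1
      rw [ShortComplex.exact_iff_epi_kernel_lift] at h
      let φ : ShortComplex.mk (s.d 2) (kernel.lift (s.d 0) (s.d 1) (s.w 0)) (by
        rw [← cancel_mono (kernel.ι (s.d 0))]; simpa using s.w 1) ⟶
        ShortComplex.mk (s.d 2) (s.d 1) (s.w 1) :=
        { τ₁ := 𝟙 _, τ₂ := 𝟙 _, τ₃ := kernel.ι _ }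
      have : IsIso φ.τ₁ := by dsimp [φ]; infer_instance
      have : IsIso φ.τ₂ := by dsimp [φ]; infer_instance
      have : Mono φ.τ₃ := by dsimp [φ]; infer_instance
      exact (ShortComplex.exact_iff_of_epi_of_isIso_of_mono φ).2 (s.ex 1)
    | succ k => exact s.ex (k+2)
  epi0 := (ShortComplex.exact_iff_epi_kernel_lift _).1 (s.ex 0)

/-- bottom short complex -/
noncomputable abbrev bot {n : ℕ} {X Y : C} (s : ExtSeq C n X Y) : ShortComplex C :=
  ShortComplex.mk (kernel.ι (s.d 0)) (s.d 0) (kernel.condition _)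

lemma bot_se {n : ℕ} {X Y : C} (s : ExtSeq C n X Y) : (bot s).ShortExact :=
  have := s.epi0
  { exact := ShortComplex.exact_kernel _
    mono_f := by dsimp; infer_instance
    epi_g := s.epi0 }

lemma isIso_d0 {X Y : C} (s : ExtSeq C 0 X Y) : IsIso (s.d 0) := by
  have := s.epi0
  have h : Mono (s.d 0) := by
    have := (s.ex 0)
    exact this.mono_g ((s.is_zero 2 (by lia)).eq_of_src _ _)
  exact isIso_of_mono_of_epi _

/-- class of an extension -/
noncomputable def cls : {n : ℕ} → {X Y : C} → ExtSeq C n X Y → Ext.{max u v} X Y n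
  | 0, _, _, s => Ext.mk₀ (s.iso0.inv ≫ (@inv _ _ _ _ (s.d 0) (isIso_d0 s)) ≫ s.isoTop.hom)
  | n+1, _, _, s => (Ext.mk₀ s.iso0.inv).comp
      ((bot_se s).extClass.comp (cls (tail s)) (add_comm 1 n)) (zero_add _)

lemma cls_nat : ∀ {n : ℕ} {X X' Y : C} (s : ExtSeq C n X Y) (t : ExtSeq C n X' Y) (f : X ⟶ X')
    (φ : ∀ i, s.ob i ⟶ t.ob i) (_ : ∀ i, s.d i ≫ φ i = φ (i + 1) ≫ t.d i)
    (_ : φ 0 ≫ t.iso0.hom = s.iso0.hom ≫ f)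
    (_ : φ (n+1) ≫ t.isoTop.hom = s.isoTop.hom),
    cls s = (Ext.mk₀ f).comp (cls t) (zero_add _) := by
  intro n
  induction n with
  | zero =>
    intro X X' Y s t f φ comm h0 h1
    have := isIso_d0 s
    have := isIso_d0 t
    simp only [cls, Ext.mk₀_comp_mk₀]
    congr 1
    rw [Iso.inv_comp_eq, IsIso.inv_comp_eq, ← h1, ← Category.assoc s.iso0.hom, ← h0]
    simp only [Category.assoc, Iso.hom_inv_id_assoc]
    rw [reassoc_of% (comm 0)]
    simp
  | succ n ih =>
    intro X X' Y s t f φ comm h0 h1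
    have key := ih (tail s) (tail t) (kernel.map (s.d 0) (t.d 0) (φ 1) (φ 0) (comm 0))
      (fun | 0 => kernel.map (s.d 0) (t.d 0) (φ 1) (φ 0) (comm 0) | k+1 => φ (k+2))
      (by
        intro i
        cases i with
        | zero =>
          dsimp [tail]
          rw [← cancel_mono (kernel.ι (t.d 0))]
          simpa using comm 1
        | succ k => exact comm (k+2))
      (by simp [tail])
      (by exact h1)
    let m : bot s ⟶ bot t :=
      { τ₁ := kernel.map (s.d 0) (t.d 0) (φ 1) (φ 0) (comm 0)
        τ₂ := φ 1
        τ₃ := φ 0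
        comm₁₂ := by simp
        comm₂₃ := (comm 0).symm }
    have nat := ShortComplex.ShortExact.extClass_naturality (bot_se s) (bot_se t) m
    have hf : f ≫ t.iso0.inv = s.iso0.inv ≫ φ 0 := by
      rw [Iso.comp_inv_eq, Category.assoc, Iso.eq_inv_comp, h0]
    simp only [cls]
    rw [Ext.mk₀_comp_mk₀_assoc, hf, ← Ext.mk₀_comp_mk₀_assoc]
    congr 1
    rw [key, ← Ext.comp_assoc_of_second_deg_zero, nat]
    exact Ext.comp_assoc _ _ _ _ _ (by lia)

lemma cls_eq_of_equiv {n : ℕ} {X Y : C} {s t : ExtSeq C n X Y} (h : YonedaEquiv s t) :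
    cls s = cls t := by
  induction h with
  | rel s t h =>
    obtain ⟨h⟩ := h
    have := cls_nat s t (𝟙 X) h.φ h.comm (by simp [h.φ0]) (by simp [h.φTop])
    simpa using this
  | refl => rfl
  | symm _ _ _ ih => exact ih.symm
  | trans _ _ _ _ _ ih1 ih2 => exact ih1.trans ih2

/-- splicing -/
noncomputable def cons {n : ℕ} {Y : C} (S : ShortComplex C) (hS : S.ShortExact)
    (t : ExtSeq C n S.X₁ Y) : ExtSeq C (n+1) S.X₃ Y where
  ob := fun | 0 => S.X₃ | 1 => S.X₂ | k+2 => t.ob (k+1)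
  d := fun | 0 => S.g | 1 => t.d 0 ≫ t.iso0.hom ≫ S.f | k+2 => t.d (k+1)
  iso0 := Iso.refl _
  isoTop := t.isoTop
  is_zero := by
    intro i hi
    match i, hi with
    | k+2, hi => exact t.is_zero (k+1) (by lia)
  w := by
    intro i
    match i with
    | 0 => simp
    | 1 => simp [reassoc_of% (t.w 0)]
    | k+2 => exact t.w (k+1)
  ex := by
    intro i
    match i with
    | 0 =>
      let φ : ShortComplex.mk (t.d 0 ≫ t.iso0.hom ≫ S.f) S.g (by simp) ⟶ S :=
        { τ₁ := t.d 0 ≫ t.iso0.hom, τ₂ := 𝟙 _, τ₃ := 𝟙 _ }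
      have := t.epi0
      have : Epi φ.τ₁ := by dsimp [φ]; infer_instance
      have : IsIso φ.τ₂ := by dsimp [φ]; infer_instance
      have : Mono φ.τ₃ := by dsimp [φ]; infer_instance
      exact (ShortComplex.exact_iff_of_epi_of_isIso_of_mono φ).2 hS.exact
    | 1 =>
      have := hS.mono_f
      let φ : ShortComplex.mk (t.d 1) (t.d 0) (t.w 0) ⟶
          ShortComplex.mk (t.d 1) (t.d 0 ≫ t.iso0.hom ≫ S.f) (by simp [reassoc_of% (t.w 0)]) :=
        { τ₁ := 𝟙 _, τ₂ := 𝟙 _, τ₃ := t.iso0.hom ≫ S.f }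
      have : IsIso φ.τ₁ := by dsimp [φ]; infer_instance
      have : IsIso φ.τ₂ := by dsimp [φ]; infer_instance
      have : Mono φ.τ₃ := by dsimp [φ]; infer_instance
      exact (ShortComplex.exact_iff_of_epi_of_isIso_of_mono φ).1 (t.ex 0)
    | k+2 => exact t.ex (k+1)
  epi0 := hS.epi_g

lemma cls_cons {n : ℕ} {Y : C} (S : ShortComplex C) (hS : S.ShortExact)
    (t : ExtSeq C n S.X₁ Y) :
    cls (cons S hS t) = hS.extClass.comp (cls t) (add_comm 1 n) := by
  have := hS.mono_f
  let κ : kernel S.g ⟶ S.X₁ := hS.exact.lift (kernel.ι S.g) (kernel.condition _)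
  have hκ : κ ≫ S.f = kernel.ι S.g := hS.exact.lift_f _ _
  have key := cls_nat (tail (cons S hS t)) t κ
    (fun | 0 => κ ≫ t.iso0.inv | k+1 => 𝟙 (t.ob (k+1)))
    (by
      intro i
      cases i with
      | zero =>
        dsimp [tail, cons]
        rw [← cancel_mono t.iso0.hom, ← cancel_mono S.f]
        simp only [Category.assoc, Iso.inv_hom_id_assoc, Category.id_comp]
        rw [hκ]
        exact kernel.lift_ι _ _ _
      | succ k =>
        dsimp [tail, cons]
        simp)
    (by
      have : (κ ≫ t.iso0.inv) ≫ t.iso0.hom = 𝟙 _ ≫ κ := by simp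
      exact this)
    (by dsimp [tail, cons]; simp)
  let m : bot (cons S hS t) ⟶ S :=
    { τ₁ := κ
      τ₂ := 𝟙 _
      τ₃ := 𝟙 _
      comm₁₂ := by
        exact hκ.trans (Category.comp_id _).symm
      comm₂₃ := by
        exact (Category.id_comp _).trans (Category.comp_id _).symm }
  have nat := ShortComplex.ShortExact.extClass_naturality (bot_se (cons S hS t)) hS m
  simp only [cls]
  have h0 : (cons S hS t).iso0.inv = 𝟙 _ := rfl
  rw [h0]
  erw [Ext.mk₀_id_comp]
  erw [key]
  erw [← Ext.comp_assoc_of_second_deg_zero, nat]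
  congr 1
  exact Ext.mk₀_id_comp _

open ZeroObject in
/-- trivial extension -/
noncomputable def triv (Y : C) : ExtSeq C 0 Y Y where
  ob := fun | 0 => Y | 1 => Y | _+2 => 0
  d := fun | 0 => 𝟙 Y | _+1 => 0
  iso0 := Iso.refl _
  isoTop := Iso.refl _
  is_zero := by
    intro i hi
    match i, hi with
    | k+2, hi => exact isZero_zero _
  w := by
    intro i
    match i with
    | 0 => simp
    | k+1 => simp
  ex := by
    intro i
    match i with
    | 0 => exact (ShortComplex.exact_iff_mono _ rfl).2 (by dsimp; infer_instance)
    | k+1 => exact ShortComplex.exact_of_isZero_X₂ _ (isZero_zero _)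
  epi0 := by dsimp; infer_instance

lemma cls_triv (Y : C) : cls (triv Y) = Ext.mk₀ (𝟙 Y) := by
  have := isIso_d0 (triv Y)
  have h : inv ((triv Y).d 0) = 𝟙 Y := by
    apply IsIso.inv_eq_of_hom_inv_id
    exact Category.comp_id _
  simp only [cls]
  rw [h]
  congr 1
  exact (Category.id_comp _).trans (Category.id_comp _)

lemma exists_pushout (S : ShortComplex C) (hS : S.ShortExact) {Y : C} (g : S.X₁ ⟶ Y) :
    ∃ s : ExtSeq C 1 S.X₃ Y, cls s = hS.extClass.comp (Ext.mk₀ g) (add_zero 1) := by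
  have := hS.mono_f
  have := hS.epi_g
  let q : pushout g S.f ⟶ S.X₃ := pushout.desc 0 S.g (by simp)
  have q1 : pushout.inl g S.f ≫ q = 0 := pushout.inl_desc _ _ _
  have q2 : pushout.inr g S.f ≫ q = S.g := pushout.inr_desc _ _ _
  let T : ShortComplex C := ShortComplex.mk (pushout.inl g S.f) q q1
  have hq : Epi q := by
    have : Epi (pushout.inr g S.f ≫ q) := by rw [q2]; infer_instance
    exact epi_of_epi (pushout.inr g S.f) _
  have hT : T.ShortExact :=
    { exact := by
        apply ShortComplex.exact_of_g_is_cokernel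
        refine CokernelCofork.IsColimit.ofπ' _ _ (fun {Z} k hk => ?_)
        have hk' : pushout.inl g S.f ≫ k = 0 := hk
        have h2 : S.f ≫ pushout.inr g S.f ≫ k = 0 := by
          rw [← pushout.condition_assoc, hk', comp_zero]
        refine ⟨hS.exact.desc (pushout.inr g S.f ≫ k) h2, ?_⟩
        apply pushout.hom_ext
        · simp only [T, hk', reassoc_of% q1, zero_comp]
        · simp only [T, reassoc_of% q2]
          exact hS.exact.g_desc _ _
      mono_f := by dsimp [T]; infer_instance
      epi_g := hq }
  let m : S ⟶ T :=
    { τ₁ := g, τ₂ := pushout.inr g S.f, τ₃ := 𝟙 _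
      comm₁₂ := by simp [T, pushout.condition]
      comm₂₃ := by simp [T, q2] }
  refine ⟨cons T hT (triv Y), ?_⟩
  rw [cls_cons, cls_triv]
  have nat := ShortComplex.ShortExact.extClass_naturality hS hT m
  exact (Ext.comp_mk₀_id _).trans ((Ext.mk₀_id_comp _).symm.trans nat.symm)

lemma cls_surj : ∀ (n : ℕ) {X Y : C} (e : Ext.{max u v} X Y (n+1)),
    ∃ s : ExtSeq C (n+1) X Y, cls s = e := by
  intro n
  induction n with
  | zero =>
    intro X Y e
    obtain ⟨P, p, hp, h⟩ := ext_efface 0 e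
    let S : ShortComplex C := ShortComplex.mk (kernel.ι p) p (kernel.condition _)
    have hS : S.ShortExact := { exact := ShortComplex.exact_kernel _ }
    obtain ⟨e', rfl⟩ := Ext.contravariant_sequence_exact₃ hS Y e h (n₀ := 0) rfl
    obtain ⟨g, rfl⟩ := (Ext.mk₀_bijective _ _).2 e'
    exact exists_pushout S hS g
  | succ n ih =>
    intro X Y e
    obtain ⟨P, p, hp, h⟩ := ext_efface _ e
    let S : ShortComplex C := ShortComplex.mk (kernel.ι p) p (kernel.condition _)
    have hS : S.ShortExact := { exact := ShortComplex.exact_kernel _ }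
    obtain ⟨e', rfl⟩ := Ext.contravariant_sequence_exact₃ hS Y e h (n₀ := n+1) (by lia)
    obtain ⟨s, rfl⟩ := ih e'
    exact ⟨cons S hS s, cls_cons _ _ _⟩

lemma subsingleton_of_extVanish {n : ℕ} (hn : 0 < n) {X Y : C} (h : extVanish C n X Y) :
    Subsingleton (Ext.{max u v} X Y n) := by
  obtain ⟨n, rfl⟩ : ∃ m, n = m + 1 := ⟨n - 1, by lia⟩
  refine ⟨fun a b => ?_⟩
  obtain ⟨s, rfl⟩ := cls_surj n a
  obtain ⟨t, rfl⟩ := cls_surj n b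
  exact cls_eq_of_equiv (h s t)

lemma summand_mem (d : ℕ) (𝒰 : Set C)
    (hU0 : ∀ Z : C, IsZero Z → Z ∈ 𝒰)
    (hUiso : ∀ X Y : C, (X ≅ Y) → X ∈ 𝒰 → Y ∈ 𝒰)
    (hrigid : ∀ i, 0 < i → i < d → ∀ U ∈ 𝒰, ∀ U' ∈ 𝒰, extVanish C i U U')
    (hcompl : ∀ W U' : C, U' ∈ 𝒰 → (W ⊞ U') ∈ 𝒰 → W ∈ 𝒰) :
    ∀ (j : ℕ), j ≤ d → ∀ (E : C), E ∈ coresSet C 𝒰 j →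
      ∀ (V : C) (i : E ⟶ V) (r : V ⟶ E), i ≫ r = 𝟙 E → V ∈ 𝒰 → E ∈ 𝒰 := by
  -- vanishing against a retract of an object of `𝒰`
  have van : ∀ (E V : C) (i : E ⟶ V) (r : V ⟶ E), i ≫ r = 𝟙 E → V ∈ 𝒰 →
      ∀ (j k : ℕ), 0 < k → k + j ≤ d → ∀ Z ∈ coresSet C 𝒰 j,
        ∀ e : Ext.{max u v} Z E k, e = 0 := by
    intro E V i r hir hV j
    have base : ∀ k, 0 < k → k < d → ∀ U ∈ 𝒰, ∀ e : Ext.{max u v} U E k, e = 0 := by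
      intro k hk hkd U hU e
      have := subsingleton_of_extVanish hk (hrigid k hk hkd U hU V hV)
      have h0 : e.comp (Ext.mk₀ i) (add_zero k) = 0 := Subsingleton.elim _ _
      rw [← Ext.comp_mk₀_id e, ← hir, ← Ext.mk₀_comp_mk₀,
        ← Ext.comp_assoc_of_third_deg_zero, h0, Ext.zero_comp]
    induction j with
    | zero =>
      intro k hk _ Z hZ e
      have hZ' : IsZero Z := hZ
      rw [← Ext.mk₀_id_comp e, hZ'.eq_of_src (𝟙 Z) 0, Ext.mk₀_zero, Ext.zero_comp]
    | succ j ih =>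
      intro k hk hkd Z hZ e
      obtain ⟨W, f, hW, hf, hc⟩ := hZ
      let S : ShortComplex C := ShortComplex.mk f (cokernel.π f) (cokernel.condition _)
      have hS : S.ShortExact := { exact := ShortComplex.exact_cokernel _ }
      obtain ⟨e', rfl⟩ := Ext.contravariant_sequence_exact₁ hS E e (n₁ := k+1) (by lia)
        (ih (k+1) (by lia) (by lia) _ hc _)
      rw [base k hk (by lia) _ hW e', Ext.comp_zero]
  intro j
  induction j with
  | zero => intro _ E hE V i r _ _; exact hU0 _ hE
  | succ j ih =>
    intro hj E hE V i r hir hV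
    obtain ⟨W, f, hW, hf, hc⟩ := hE
    let S : ShortComplex C := ShortComplex.mk f (cokernel.π f) (cokernel.condition _)
    have hS : S.ShortExact := { exact := ShortComplex.exact_cokernel _ }
    obtain ⟨σ, hσ⟩ := Ext.covariant_sequence_exact₃ _ hS (Ext.mk₀ (𝟙 S.X₃)) (zero_add 1)
      (van E V i r hir hV j 1 (by lia) (by lia) _ hc _)
    obtain ⟨σ, rfl⟩ := (Ext.mk₀_bijective _ _).2 σ
    rw [Ext.mk₀_comp_mk₀] at hσ
    have hσ' : σ ≫ cokernel.π f = 𝟙 _ := (Ext.mk₀_bijective _ _).1 hσ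
    have hC : cokernel f ∈ 𝒰 := ih (by lia) _ hc W σ (cokernel.π f) hσ' hW
    have sp : S.Splitting := ShortComplex.Splitting.ofExactOfSection S hS.exact σ hσ' hf
    exact hcompl E (cokernel f) hC (hUiso _ _ sp.isoBinaryBiproduct hW)
end
end YExt

/-- a weakly right maximal `d`-rigid subcategory which is closed under
additive complements is closed under direct summands. -/
theorem closed_under_additive_complements_closed_under_summands
    (A : Type u) [Category.{v} A] [Abelian A] (d : ℕ) (hd : 1 ≤ d)
    (𝒰 : Set A)
    (hU0 : ∀ Z : A, IsZero Z → Z ∈ 𝒰)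
    (hUadd : ∀ X Y : A, X ∈ 𝒰 → Y ∈ 𝒰 → (X ⊞ Y) ∈ 𝒰)
    (hUiso : ∀ X Y : A, (X ≅ Y) → X ∈ 𝒰 → Y ∈ 𝒰)
    (hrigid : ∀ i, 0 < i → i < d → ∀ U ∈ 𝒰, ∀ U' ∈ 𝒰, extVanish A i U U')
    (hmax : ∀ E : A, E ∈ coresSet A 𝒰 d)
    (hcompl : ∀ W U' : A, U' ∈ 𝒰 → (W ⊞ U') ∈ 𝒰 → W ∈ 𝒰) :
    ∀ E E' : A, (E ⊞ E') ∈ 𝒰 → E ∈ 𝒰 ∧ E' ∈ 𝒰 := by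
  intro E E' h
  have key := YExt.summand_mem d 𝒰 hU0 hUiso hrigid hcompl d le_rfl
  exact ⟨key E (hmax E) _ biprod.inl biprod.fst (by simp) h,
    key E' (hmax E') _ biprod.inr biprod.snd (by simp) h⟩
end
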